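/- arXiv:2011.07767 — 6 statements merged into one kernel-verified Lean document; each statement's English description precedes it below -/
import Mathlib

section
/- Let q, a, b, c, d be complex numbers with |q| < 1, |ad| < 1 and |cq| < 1 (and such that no denominator factor (b;q)_n, (cq;q)_n, (ad;q)_m, 1 - ad q^m, 1 - b q^m vanishes, and ad ≠ b). Then ∑_{n=1}^∞ ( (b/a;q)_n (c/d;q)_n (ad)^n ) / ( (b;q)_n (cq;q)_n ) = ((a-b)(d-c)/(ad-b)) · ∑_{m=0}^∞ ( (a;q)_m (bd/c;q)_m c^m ) / ( (b;q)_m (ad;q)_m ) · ( (ad q^m)/(1 - ad q^m) - (b q^m)/(1 - b q^m) ). -/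
/-- The finite q-Pochhammer symbol `(A;q)_n = (1-A)(1-Aq)⋯(1-Aq^{n-1})`. -/
noncomputable def qPoch (q A : ℂ) (n : ℕ) : ℂ := ∏ k ∈ Finset.range n, (1 - A * q ^ k)

/-- The infinite q-Pochhammer symbol `(A;q)_∞ = ∏_{k≥0} (1 - A q^k)`. -/
noncomputable def qPochInf (q A : ℂ) : ℂ := ∏' k : ℕ, (1 - A * q ^ k)

open Filter Topology

theorem qPoch_zero (q A : ℂ) : qPoch q A 0 = 1 :=
  Finset.prod_range_zero _

theorem qPoch_succ (q A : ℂ) (n : ℕ) : qPoch q A (n + 1) = qPoch q A n * (1 - A * q ^ n) :=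
  Finset.prod_range_succ _ _

theorem qPoch_succ' (q A : ℂ) (n : ℕ) : qPoch q A (n + 1) = (1 - A) * qPoch q (A * q) n := by
  simp only [qPoch, Finset.prod_range_succ', pow_zero, mul_one, pow_succ', mul_assoc]
  rw [mul_comm]

theorem qPoch_ne_zero {q A : ℂ} (h : ∀ m : ℕ, 1 - A * q ^ m ≠ 0) (n : ℕ) : qPoch q A n ≠ 0 :=
  Finset.prod_ne_zero_iff.mpr fun m _ => h m

theorem summable_norm_neg_mul_pow {q : ℂ} (hq : ‖q‖ < 1) (A : ℂ) :
    Summable fun k : ℕ => ‖-(A * q ^ k)‖ := by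
  simpa [norm_mul, norm_pow] using
    (summable_geometric_of_lt_one (norm_nonneg q) hq).mul_left ‖A‖

theorem tendsto_qPoch {q : ℂ} (hq : ‖q‖ < 1) (A : ℂ) :
    Tendsto (qPoch q A) atTop (𝓝 (qPochInf q A)) := by
  have h := (multipliable_one_add_of_summable
    (summable_norm_neg_mul_pow hq A)).hasProd.tendsto_prod_nat
  simp only [← sub_eq_add_neg] at h
  exact h

theorem qPochInf_ne_zero {q A : ℂ} (hq : ‖q‖ < 1) (h : ∀ m : ℕ, 1 - A * q ^ m ≠ 0) :
    qPochInf q A ≠ 0 := by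
  have := tprod_one_add_ne_zero_of_summable (f := fun k : ℕ => -(A * q ^ k))
    (by simpa only [← sub_eq_add_neg] using h) (summable_norm_neg_mul_pow hq A)
  simp only [← sub_eq_add_neg] at this
  exact this

theorem exists_norm_qPoch_le {q : ℂ} (hq : ‖q‖ < 1) (A : ℂ) :
    ∃ K : ℝ, 0 ≤ K ∧ ∀ n, ‖qPoch q A n‖ ≤ K := by
  obtain ⟨K, hK⟩ := (tendsto_qPoch hq A).norm.bddAbove_range
  have hbound : ∀ n, ‖qPoch q A n‖ ≤ K := fun n => hK ⟨n, rfl⟩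
  exact ⟨K, (norm_nonneg _).trans (hbound 0), hbound⟩

theorem exists_norm_inv_qPoch_le {q A : ℂ} (hq : ‖q‖ < 1) (h : ∀ m : ℕ, 1 - A * q ^ m ≠ 0) :
    ∃ K : ℝ, 0 ≤ K ∧ ∀ n, ‖(qPoch q A n)⁻¹‖ ≤ K := by
  obtain ⟨K, hK⟩ := ((tendsto_qPoch hq A).inv₀ (qPochInf_ne_zero hq h)).norm.bddAbove_range
  have hbound : ∀ n, ‖(qPoch q A n)⁻¹‖ ≤ K := fun n => hK ⟨n, rfl⟩
  exact ⟨K, (norm_nonneg _).trans (hbound 0), hbound⟩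

/-- Summation of a WZ-type pair with geometrically decaying entries. -/
theorem tsum_eq_tsum_of_sub_eq_sub {f w : ℕ → ℕ → ℂ} {r s K L : ℝ}
    (hr : 0 ≤ r) (hr1 : r < 1) (hs : 0 ≤ s) (hs1 : s < 1)
    (hf : ∀ m n, ‖f m n‖ ≤ K * s ^ m * r ^ n) (hw : ∀ m n, ‖w m n‖ ≤ L * s ^ m * r ^ n)
    (h : ∀ m n, f m n - f (m + 1) n = w m n - w m (n + 1)) :
    ∑' n, f 0 n = ∑' m, w m 0 := by
  have hgr := summable_geometric_of_lt_one hr hr1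
  have hgs := summable_geometric_of_lt_one hs hs1
  have hfs : ∀ m, Summable (f m) := fun m =>
    Summable.of_norm_bounded (hgr.mul_left (K * s ^ m)) (hf m)
  have hws : Summable fun m => w m 0 :=
    Summable.of_norm_bounded (hgs.mul_left L) fun m => by simpa using hw m 0
  have hw0 : ∀ m, Tendsto (w m) atTop (𝓝 0) := fun m =>
    squeeze_zero_norm (hw m) (by
      simpa using (tendsto_pow_atTop_nhds_zero_of_lt_one hr hr1).const_mul (L * s ^ m))
  have hstep : ∀ m, ∑' n, f m n - ∑' n, f (m + 1) n = w m 0 := fun m => by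
    have h1 := ((hfs m).hasSum.sub (hfs (m + 1)).hasSum).tendsto_sum_nat
    have h2 : Tendsto (fun N => w m 0 - w m N) atTop (𝓝 (w m 0 - 0)) :=
      tendsto_const_nhds.sub (hw0 m)
    simp only [h, Finset.sum_range_sub'] at h1
    simpa using tendsto_nhds_unique h1 h2
  have hS0 : Tendsto (fun m => ∑' n, f m n) atTop (𝓝 0) := by
    refine squeeze_zero_norm (a := fun m => K * s ^ m * ∑' n, r ^ n) (fun m => ?_) ?_
    · rw [← tsum_mul_left]
      exact tsum_of_norm_bounded (hgr.mul_left _).hasSum (hf m)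
    · simpa using ((tendsto_pow_atTop_nhds_zero_of_lt_one hs hs1).const_mul K).mul_const
        (∑' n, r ^ n)
  have h1 := hws.hasSum.tendsto_sum_nat
  simp only [← hstep, Finset.sum_range_sub'] at h1
  have h2 : Tendsto (fun M => ∑' n, f 0 n - ∑' n, f M n) atTop (𝓝 (∑' n, f 0 n - 0)) :=
    tendsto_const_nhds.sub hS0
  simpa [hstep] using tendsto_nhds_unique h2 h1

theorem exists_norm_kernel_le {q a b c d : ℂ} (hq : ‖q‖ < 1)
    (hb : ∀ m : ℕ, 1 - b * q ^ m ≠ 0)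
    (hcqn : ∀ m : ℕ, 1 - c * q * q ^ m ≠ 0)
    (hadn : ∀ m : ℕ, 1 - a * d * q ^ m ≠ 0) (i j : ℕ) :
    ∃ K : ℝ, ∀ m n, ‖qPoch q a m * qPoch q (b * d / c) m * (c * q) ^ m *
      (qPoch q (b * q / a) n * qPoch q (c * q / d) n * (a * d) ^ n) * q ^ (m * n) *
      ((qPoch q b (m + n + 1))⁻¹ * (qPoch q (a * d) (m + i))⁻¹ *
        (qPoch q (c * q) (n + j))⁻¹)‖ ≤ K * ‖c * q‖ ^ m * ‖a * d‖ ^ n := by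
  obtain ⟨K₁, h₁, H₁⟩ := exists_norm_qPoch_le hq a
  obtain ⟨K₂, h₂, H₂⟩ := exists_norm_qPoch_le hq (b * d / c)
  obtain ⟨K₃, h₃, H₃⟩ := exists_norm_qPoch_le hq (b * q / a)
  obtain ⟨K₄, h₄, H₄⟩ := exists_norm_qPoch_le hq (c * q / d)
  obtain ⟨K₅, h₅, H₅⟩ := exists_norm_inv_qPoch_le hq hb
  obtain ⟨K₆, h₆, H₆⟩ := exists_norm_inv_qPoch_le hq hadn
  obtain ⟨K₇, h₇, H₇⟩ := exists_norm_inv_qPoch_le hq hcqn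
  refine ⟨K₁ * K₂ * (K₃ * K₄) * (K₅ * K₆ * K₇), fun m n => ?_⟩
  have hpow : ‖q ^ (m * n)‖ ≤ 1 := by
    rw [norm_pow]
    exact pow_le_one₀ (norm_nonneg q) hq.le
  have key : ‖qPoch q a m * qPoch q (b * d / c) m * (c * q) ^ m *
      (qPoch q (b * q / a) n * qPoch q (c * q / d) n * (a * d) ^ n) * q ^ (m * n) *
      ((qPoch q b (m + n + 1))⁻¹ * (qPoch q (a * d) (m + i))⁻¹ *
        (qPoch q (c * q) (n + j))⁻¹)‖ ≤
      K₁ * K₂ * ‖c * q‖ ^ m * (K₃ * K₄ * ‖a * d‖ ^ n) * 1 * (K₅ * K₆ * K₇) := by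
    rw [norm_mul, norm_mul _ (q ^ (m * n)), norm_mul _ (_ * _ * (a * d) ^ n),
      norm_mul _ ((c * q) ^ m), norm_mul (qPoch q a m), norm_mul _ ((a * d) ^ n),
      norm_mul (qPoch q (b * q / a) n), norm_mul _ (qPoch q (c * q) (n + j))⁻¹,
      norm_mul (qPoch q b (m + n + 1))⁻¹, norm_pow (c * q), norm_pow (a * d)]
    gcongr
    exacts [H₁ m, H₂ m, H₃ n, H₄ n, H₅ _, H₆ _, H₇ _]
  exact key.trans_eq (by ring)

theorem stmt0 (q a b c d : ℂ) (hq : ‖q‖ < 1) (had : ‖a * d‖ < 1) (hcq : ‖c * q‖ < 1)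
    (ha : a ≠ 0) (hc : c ≠ 0) (hd : d ≠ 0) (hadb : a * d ≠ b)
    (hb : ∀ m : ℕ, 1 - b * q ^ m ≠ 0)
    (hcqn : ∀ m : ℕ, 1 - c * q ^ (m + 1) ≠ 0)
    (hadn : ∀ m : ℕ, 1 - a * d * q ^ m ≠ 0) :
    ∑' n : ℕ, (qPoch q (b / a) (n + 1) * qPoch q (c / d) (n + 1) * (a * d) ^ (n + 1)) /
        (qPoch q b (n + 1) * qPoch q (c * q) (n + 1))
      = ((a - b) * (d - c) / (a * d - b)) *
        ∑' m : ℕ, (qPoch q a m * qPoch q (b * d / c) m * c ^ m) /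
            (qPoch q b m * qPoch q (a * d) m) *
          ((a * d * q ^ m) / (1 - a * d * q ^ m) - (b * q ^ m) / (1 - b * q ^ m)) := by
  have hcqn' : ∀ m : ℕ, 1 - c * q * q ^ m ≠ 0 := fun m => by
    simpa only [pow_succ', mul_assoc] using hcqn m
  obtain ⟨K, hK⟩ := exists_norm_kernel_le hq hb hcqn' hadn 0 1
  obtain ⟨L, hL⟩ := exists_norm_kernel_le hq hb hcqn' hadn 1 0
  have hB := qPoch_ne_zero hb
  have hC := qPoch_ne_zero hcqn'
  have hD := qPoch_ne_zero hadn
  have key := tsum_eq_tsum_of_sub_eq_sub (norm_nonneg _) had (norm_nonneg _) hcq hK hL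
    (fun m n => by
      have e1 : m + 1 + n + 1 = m + n + 1 + 1 := by ring
      have e2 : m + (n + 1) + 1 = m + n + 1 + 1 := by ring
      have hBn := hB (m + n + 1)
      have hCn := hC n
      have hDm := hD m
      have h1 := hb (m + n + 1)
      have h2 := hcqn' n
      have h3 := hadn m
      rw [e1, e2, qPoch_succ q b (m + n + 1)]
      simp only [qPoch_succ q a, qPoch_succ q (b * d / c), qPoch_succ q (b * q / a),
        qPoch_succ q (c * q / d), qPoch_succ q (a * d), qPoch_succ q (c * q), add_zero]
      generalize qPoch q b (m + n + 1) = B at *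
      generalize qPoch q (c * q) n = C at *
      generalize qPoch q (a * d) m = D at *
      generalize hU : 1 - b * q ^ (m + n + 1) = U at *
      generalize hV : 1 - c * q * q ^ n = V at *
      generalize hW : 1 - a * d * q ^ m = W at *
      generalize qPoch q (b * d / c) m = E
      generalize qPoch q (b * q / a) n = F
      generalize qPoch q (c * q / d) n = G
      field_simp
      subst hU hV hW
      ring)
  have hsub : a * d - b ≠ 0 := sub_ne_zero.mpr hadb
  have hl : ∀ n : ℕ, (qPoch q (b / a) (n + 1) * qPoch q (c / d) (n + 1) * (a * d) ^ (n + 1)) /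
      (qPoch q b (n + 1) * qPoch q (c * q) (n + 1)) = (a - b) * (d - c) *
      (qPoch q a 0 * qPoch q (b * d / c) 0 * (c * q) ^ 0 *
      (qPoch q (b * q / a) n * qPoch q (c * q / d) n * (a * d) ^ n) * q ^ (0 * n) *
      ((qPoch q b (0 + n + 1))⁻¹ * (qPoch q (a * d) (0 + 0))⁻¹ *
        (qPoch q (c * q) (n + 1))⁻¹)) := fun n => by
    have hBn := hB (n + 1)
    have hCn := hC (n + 1)
    rw [qPoch_succ' q (b / a), qPoch_succ' q (c / d), div_mul_eq_mul_div, div_mul_eq_mul_div]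
    simp only [qPoch_zero, zero_add, zero_mul, pow_zero]
    generalize qPoch q (c * q) (n + 1) = C at *
    field_simp
    ring
  have hr : ∀ m : ℕ, (qPoch q a m * qPoch q (b * d / c) m * c ^ m) /
      (qPoch q b m * qPoch q (a * d) m) *
      ((a * d * q ^ m) / (1 - a * d * q ^ m) - (b * q ^ m) / (1 - b * q ^ m)) = (a * d - b) *
      (qPoch q a m * qPoch q (b * d / c) m * (c * q) ^ m *
      (qPoch q (b * q / a) 0 * qPoch q (c * q / d) 0 * (a * d) ^ 0) * q ^ (m * 0) *
      ((qPoch q b (m + 0 + 1))⁻¹ * (qPoch q (a * d) (m + 1))⁻¹ *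
        (qPoch q (c * q) (0 + 0))⁻¹)) := fun m => by
    have hBm := hB m
    have hDm := hD m
    have h1 := hb m
    have h3 := hadn m
    simp only [qPoch_zero, add_zero, mul_zero, pow_zero, qPoch_succ, mul_pow]
    generalize qPoch q (a * d) m = D at *
    generalize hU : 1 - b * q ^ m = U at *
    generalize hW : 1 - a * d * q ^ m = W at *
    field_simp
    subst hU hW
    ring
  simp only [hl, hr, tsum_mul_left]
  rw [key, ← mul_assoc, div_mul_cancel₀ _ hsub]
end

section
/- For every integer m, every positive integer n, and every complex number a, one has ∑_{π ∈ D(n)} (-1)^{#(π)-1} ∑_{j=1}^{s(π)} (ℓ(π) - s(π) + j)^m · a^{ℓ(π) - s(π) + j} = ∑_{d | n} d^m a^d, where the sum on the right runs over the positive divisors d of n. Here, for negative m, d^m and (ℓ(π)-s(π)+j)^m denote the corresponding negative integer powers of positive integers, taken in ℂ. -/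
open Finset

open scoped Classical

/-- The largest part `ℓ(π)` of a partition. -/
def largestPart {n : ℕ} (p : n.Partition) : ℕ := p.parts.toFinset.sup id

/-- The smallest part `s(π)` of a partition. -/
noncomputable def smallestPart {n : ℕ} (p : n.Partition) : ℕ := sInf {j | j ∈ p.parts}

/-- The number of parts `#(π)` of a partition. -/
def numParts {n : ℕ} (p : n.Partition) : ℕ := Multiset.card p.parts

/-- `ν(j)`: the multiplicity of `j` as a part of the partition. -/
def mult {n : ℕ} (p : n.Partition) (j : ℕ) : ℕ := p.parts.count j

/-- `ν_d(π)`: the number of distinct parts of the partition. -/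
def numDistinctParts {n : ℕ} (p : n.Partition) : ℕ := p.parts.toFinset.card

/-- `D(n)`: the partitions of `n` into distinct parts. -/
def D (n : ℕ) : Finset (n.Partition) := Finset.univ.filter fun p => p.parts.Nodup

section SignedCount

open Polynomial

theorem sum_X_pow_mul_prod_mul_one_sub {R : Type*} [CommRing R] (t r : ℕ) :
    (∑ i ∈ range r, (X : R[X]) ^ (t + 1 + i) * ∏ j ∈ range t, (1 - X ^ (i + 1 + j))) *
        (1 - X ^ (t + 1)) =
      (X ^ (t + 1) - X ^ (t + 1 + r)) * ∏ j ∈ range t, (1 - X ^ (r + 1 + j)) := by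
  induction r with
  | zero => simp
  | succ r ih =>
    have h : (∏ j ∈ range t, (1 - (X : R[X]) ^ (r + 1 + j))) * (1 - X ^ (r + 1 + t)) =
        (∏ j ∈ range t, (1 - (X : R[X]) ^ (r + 1 + 1 + j))) * (1 - X ^ (r + 1)) := by
      rw [← prod_range_succ, prod_range_succ']
      simp only [add_zero, add_assoc, add_comm 1]
    rw [sum_range_succ, add_mul, ih]
    linear_combination (X : R[X]) ^ (t + 1) * h

theorem X_pow_dvd_prod_one_sub_sub_one {R : Type*} [CommRing R] (t r : ℕ) :
    (X : R[X]) ^ (r + 1) ∣ (∏ j ∈ range t, (1 - X ^ (r + 1 + j))) - 1 := by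
  induction t with
  | zero => simp
  | succ t ih =>
    rw [prod_range_succ]
    have h : (X : R[X]) ^ (r + 1) ∣ X ^ (r + 1 + t) := pow_dvd_pow _ (by omega)
    convert ih.sub (h.mul_left (∏ j ∈ range t, (1 - X ^ (r + 1 + j)))) using 1
    ring

theorem coeff_sum_X_pow_mul_prod {R : Type*} [CommRing R] (t r n : ℕ) (hn : n ≤ r) :
    (∑ i ∈ range r, (X : R[X]) ^ (t + 1 + i) * ∏ j ∈ range t, (1 - X ^ (i + 1 + j))).coeff n =
      if 0 < n ∧ t + 1 ∣ n then 1 else 0 := by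
  have key := sum_X_pow_mul_prod_mul_one_sub (R := R) t r
  set A := ∑ i ∈ range r, (X : R[X]) ^ (t + 1 + i) * ∏ j ∈ range t, (1 - X ^ (i + 1 + j))
  have hdvd : (X : R[X]) ^ (r + 1) ∣ A * (1 - X ^ (t + 1)) - X ^ (t + 1) := by
    have h : (X : R[X]) ^ (r + 1) ∣ X ^ (t + 1 + r) := pow_dvd_pow _ (by omega)
    rw [key]
    convert ((X_pow_dvd_prod_one_sub_sub_one (R := R) t r).mul_left (X ^ (t + 1))).sub
      (h.mul_right (∏ j ∈ range t, (1 - X ^ (r + 1 + j)))) using 1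
    ring
  rw [X_pow_dvd_iff] at hdvd
  induction n using Nat.strong_induction_on with
  | _ n ih =>
    have h := hdvd n (by omega)
    simp only [mul_sub, mul_one, coeff_sub, coeff_mul_X_pow', coeff_X_pow] at h
    by_cases hk : t + 1 ≤ n
    · have h' := ih (n - (t + 1)) (by omega) (by omega)
      rw [if_pos hk, h'] at h
      by_cases he : n = t + 1
      · subst he
        simp_all [sub_eq_zero]
      · have hd : t + 1 ∣ n - (t + 1) ↔ t + 1 ∣ n := by
          rw [Nat.dvd_sub_self_right]; simp; omega
        simp only [he, if_false, hd, sub_zero, sub_eq_zero] at h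
        rw [h]
        congr 1
        simp only [eq_iff_iff]
        have : 0 < n - (t + 1) ∧ 0 < n := by omega
        simp [this]
    · have hnd : ¬ (0 < n ∧ t + 1 ∣ n) := fun h => hk (Nat.le_of_dvd h.1 h.2)
      rw [if_neg hk, if_neg (by omega)] at h
      simpa [hnd] using h

theorem prod_one_sub_X_pow {R : Type*} [CommRing R] (s : Finset ℕ) :
    ∏ i ∈ s, (1 - (X : R[X]) ^ i) = ∑ u ∈ s.powerset, C ((-1) ^ #u) * X ^ (∑ i ∈ u, i) := by
  simp only [sub_eq_add_neg, prod_one_add, prod_neg, map_pow, map_neg, map_one]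
  exact sum_congr rfl fun u _ => by rw [Finset.prod_pow_eq_pow_sum]

/-- The finite sets of positive integers with sum `n`. -/
def distinctPartSets (n : ℕ) : Finset (Finset ℕ) := {T ∈ (Icc 1 n).powerset | ∑ i ∈ T, i = n}

theorem mem_distinctPartSets {n : ℕ} {T : Finset ℕ} :
    T ∈ distinctPartSets n ↔ 0 ∉ T ∧ ∑ i ∈ T, i = n := by
  simp only [distinctPartSets, mem_filter, mem_powerset, and_congr_left_iff]
  rintro rfl
  constructor
  · intro h h0
    simpa using h h0
  · intro h i hi
    exact mem_Icc.2 ⟨Nat.pos_of_ne_zero fun h0 => h (h0 ▸ hi),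
      single_le_sum (f := fun i => i) (fun _ _ => Nat.zero_le _) hi⟩

theorem sum_distinctPartSets_window {R : Type*} [CommRing R] (n t : ℕ) (hn : 0 < n) :
    ∑ T ∈ distinctPartSets n with t + 1 ≤ T.sup id ∧ ∀ i ∈ T, T.sup id ≤ i + t,
        (-1 : R) ^ (#T - 1) = if t + 1 ∣ n then 1 else 0 := by
  have key := coeff_sum_X_pow_mul_prod (R := R) t n n le_rfl
  simp only [hn, true_and] at key
  rw [← key]
  have hprod (i : ℕ) : ∏ j ∈ range t, (1 - (X : R[X]) ^ (i + 1 + j)) =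
      ∏ j ∈ Ico (i + 1) (i + 1 + t), (1 - (X : R[X]) ^ j) := by
    rw [prod_Ico_eq_prod_range]; simp
  simp only [hprod, prod_one_sub_X_pow, mul_sum, finsetSum_coeff]
  simp only [mul_left_comm (X ^ _) (C _), ← pow_add, coeff_C_mul, coeff_X_pow, mul_ite, mul_one,
    mul_zero]
  rw [sum_sigma', ← sum_filter]
  have hsup (i : ℕ) (U : Finset ℕ) (hU : U ⊆ Ico (i + 1) (i + 1 + t)) :
      (insert (t + 1 + i) U).sup id = t + 1 + i ∧ t + 1 + i ∉ U := by
    constructor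
    · rw [sup_insert, id, sup_eq_left]
      exact Finset.sup_le fun j hj => by have := mem_Ico.1 (hU hj); simp; omega
    · intro h
      have := mem_Ico.1 (hU h)
      omega
  refine sum_bij' (fun T _ => (⟨T.sup id - (t + 1), T.erase (T.sup id)⟩ : Σ _ : ℕ, Finset ℕ))
    (fun x _ => insert (t + 1 + x.1) x.2) ?_ ?_ ?_ ?_ ?_
  · intro T hT
    simp only [mem_filter, mem_distinctPartSets] at hT
    obtain ⟨⟨h0, hs⟩, hk, hw⟩ := hT
    have hne : T.Nonempty := by
      rw [nonempty_iff_ne_empty]; rintro rfl; simp at hs; omega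
    obtain ⟨l, hl, hl'⟩ := exists_mem_eq_sup T hne id
    rw [hl', id] at hk hw
    simp only [hl', id, mem_filter, mem_sigma, mem_range, mem_powerset]
    have hle : l ≤ n := hs ▸ single_le_sum (f := fun i => i) (fun _ _ => Nat.zero_le _) hl
    refine ⟨⟨by omega, fun i hi => ?_⟩, ?_⟩
    · have h1 := mem_erase.1 hi
      have h2 := hw i h1.2
      have h3 : i ≤ l := (le_sup (f := id) h1.2).trans_eq hl'
      rw [mem_Ico]; omega
    · rw [← hs, ← add_sum_erase T (fun i => i) hl]; omega
  · rintro ⟨i, U⟩ hx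
    simp only [mem_filter, mem_sigma, mem_range, mem_powerset] at hx
    obtain ⟨⟨-, hU⟩, hs⟩ := hx
    obtain ⟨h1, h2⟩ := hsup i U hU
    simp only [mem_filter, mem_distinctPartSets, h1, sum_insert h2, mem_insert, not_or]
    refine ⟨⟨⟨by omega, fun h => by simpa using hU h⟩, hs.symm⟩, by omega, ?_⟩
    rintro j (rfl | hj)
    · omega
    · have := mem_Ico.1 (hU hj); omega
  · intro T hT
    simp only [mem_filter, mem_distinctPartSets] at hT
    obtain ⟨⟨h0, hs⟩, hk, hw⟩ := hT
    have hne : T.Nonempty := by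
      rw [nonempty_iff_ne_empty]; rintro rfl; simp at hs; omega
    obtain ⟨l, hl, hl'⟩ := exists_mem_eq_sup T hne id
    simp only
    rw [Nat.add_sub_cancel' hk, insert_erase (hl' ▸ hl)]
  · rintro ⟨i, U⟩ hx
    simp only [mem_filter, mem_sigma, mem_range, mem_powerset] at hx
    obtain ⟨h1, h2⟩ := hsup i U hx.1.2
    simp [h1, h2]
  · intro T hT
    simp only [mem_filter, mem_distinctPartSets] at hT
    obtain ⟨⟨h0, hs⟩, hk, hw⟩ := hT
    have hne : T.Nonempty := by
      rw [nonempty_iff_ne_empty]; rintro rfl; simp at hs; omega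
    obtain ⟨l, hl, hl'⟩ := exists_mem_eq_sup T hne id
    rw [card_erase_of_mem (hl' ▸ hl)]

end SignedCount

theorem sum_Icc_window {M : Type*} [AddCommMonoid M] (g : ℕ → M) {n s l : ℕ} (hs : 0 < s)
    (hsl : s ≤ l) (hl : l ≤ n) :
    ∑ j ∈ Icc 1 s, g (l - s + j) = ∑ t ∈ range n with t + 1 ≤ l ∧ l ≤ s + t, g (t + 1) := by
  refine sum_nbij' (fun j => l - s + j - 1) (fun t => t + 1 + s - l) ?_ ?_ ?_ ?_ ?_
  · intro j hj; simp only [mem_Icc, mem_filter, mem_range] at *; omega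
  · intro j hj; simp only [mem_Icc, mem_filter, mem_range] at *; omega
  · intro j hj; simp only [mem_Icc] at *; omega
  · intro j hj; simp only [mem_filter, mem_range] at *; omega
  · intro j hj
    rw [mem_Icc] at hj
    congr 1
    omega

theorem sum_D_eq_sum_distinctPartSets {M : Type*} [AddCommMonoid M] (n : ℕ)
    (f : Finset ℕ → M) :
    ∑ p ∈ D n, f p.parts.toFinset = ∑ T ∈ distinctPartSets n, f T := by
  refine sum_bij (fun p _ => p.parts.toFinset) ?_ ?_ ?_ fun _ _ => rfl
  · intro p hp
    have hp : p.parts.Nodup := by simpa [D] using hp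
    rw [mem_distinctPartSets]
    refine ⟨fun h => (p.parts_pos (Multiset.mem_toFinset.1 h)).ne rfl, ?_⟩
    rw [Finset.sum, Multiset.toFinset_val, hp.dedup, Multiset.map_id', p.parts_sum]
  · intro p hp q hq h
    have hp : p.parts.Nodup := by simpa [D] using hp
    have hq : q.parts.Nodup := by simpa [D] using hq
    ext1
    rw [← hp.dedup, ← hq.dedup, ← Multiset.toFinset_val, h, Multiset.toFinset_val]
  · intro T hT
    obtain ⟨h0, hs⟩ := mem_distinctPartSets.1 hT
    refine ⟨⟨T.val, fun {i} hi => Nat.pos_of_ne_zero fun h => h0 (h ▸ hi), ?_⟩, ?_, ?_⟩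
    · rw [← hs, Finset.sum, Multiset.map_id']
    · simp [D, T.nodup]
    · simp

theorem signed_sum_eq_sum_window (n : ℕ) (hn : 0 < n) (g : ℕ → ℂ) (p : n.Partition)
    (hp : p ∈ D n) :
    (-1 : ℂ) ^ (numParts p - 1) *
        ∑ j ∈ Icc 1 (smallestPart p), g (largestPart p - smallestPart p + j) =
      ∑ t ∈ range n, if t + 1 ≤ p.parts.toFinset.sup id ∧
          ∀ i ∈ p.parts.toFinset, p.parts.toFinset.sup id ≤ i + t then
        (-1 : ℂ) ^ (#p.parts.toFinset - 1) * g (t + 1) else 0 := by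
  have hp : p.parts.Nodup := by simpa [D] using hp
  have hcard : numParts p = #p.parts.toFinset := (Multiset.toFinset_card_of_nodup hp).symm
  have hne : {j | j ∈ p.parts}.Nonempty := by
    obtain ⟨j, hj⟩ := Multiset.exists_mem_of_ne_zero (s := p.parts) fun h => by
      have := p.parts_sum
      simp [h] at this
      omega
    exact ⟨j, hj⟩
  have hs : smallestPart p ∈ p.parts := Nat.sInf_mem hne
  have hmin : ∀ i ∈ p.parts, smallestPart p ≤ i := fun i hi => Nat.sInf_le hi
  have hl : largestPart p ≤ n := Finset.sup_le fun i hi => by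
    have := Multiset.le_sum_of_mem (Multiset.mem_toFinset.1 hi)
    rwa [p.parts_sum] at this
  have hsl : smallestPart p ≤ largestPart p :=
    le_sup (f := id) (Multiset.mem_toFinset.2 hs)
  rw [sum_Icc_window g (p.parts_pos hs) hsl hl, hcard, mul_sum, sum_filter]
  refine sum_congr rfl fun t _ => ?_
  congr 1
  simp only [eq_iff_iff, Multiset.mem_toFinset]
  refine and_congr Iff.rfl ⟨fun h i hi => ?_, fun h => h _ hs⟩
  exact h.trans (Nat.add_le_add_right (hmin i hi) t)

theorem stmt3 (m : ℤ) (n : ℕ) (hn : 0 < n) (a : ℂ) :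
    ∑ p ∈ D n, (-1 : ℂ) ^ (numParts p - 1) *
      ∑ j ∈ Finset.Icc 1 (smallestPart p),
        ((largestPart p - smallestPart p + j : ℕ) : ℂ) ^ m *
          a ^ (largestPart p - smallestPart p + j)
    = ∑ d ∈ n.divisors, (d : ℂ) ^ m * a ^ d := by
  have hrange : ∑ d ∈ n.divisors, (d : ℂ) ^ m * a ^ d =
      ∑ t ∈ range n, if t + 1 ∣ n then ((t + 1 : ℕ) : ℂ) ^ m * a ^ (t + 1) else 0 := by
    rw [Nat.divisors, sum_filter, sum_Ico_eq_sum_range]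
    simp only [add_comm 1, Nat.add_sub_cancel]
  rw [sum_congr rfl (signed_sum_eq_sum_window n hn fun d => (d : ℂ) ^ m * a ^ d),
    sum_D_eq_sum_distinctPartSets n fun T => ∑ t ∈ range n,
      if t + 1 ≤ T.sup id ∧ ∀ i ∈ T, T.sup id ≤ i + t then
        (-1 : ℂ) ^ (#T - 1) * (((t + 1 : ℕ) : ℂ) ^ m * a ^ (t + 1)) else 0,
    sum_comm, hrange]
  refine sum_congr rfl fun t _ => ?_
  rw [← sum_filter, ← sum_mul, sum_distinctPartSets_window n t hn, ite_mul, one_mul, zero_mul]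
end

section
/- For every positive integer n, one has ∑_{π ∈ D(n)} (-1)^{#(π)-1} s(π) = d(n), where d(n) is the number of positive divisors of n. -/
open Finset

open scoped Classical

/-- The nonempty finite sets of natural numbers (possibly containing `0`) with sum `n`. -/
def setsOfSum (n : ℕ) : Finset (Finset ℕ) :=
  (range (n + 1)).powerset.filter fun T => T.Nonempty ∧ ∑ i ∈ T, i = n

/-- The set `T` lies in a window of `N` consecutive integers. -/
def InWindow (N : ℕ) (T : Finset ℕ) : Prop := ∀ a ∈ T, ∀ b ∈ T, a < b + N

/-- The sign `(-1) ^ (#T - 1)` of a nonempty finite set. -/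
def setSign (T : Finset ℕ) : ℤ := (-1) ^ (T.card + 1)

theorem mem_setsOfSum {n : ℕ} {T : Finset ℕ} :
    T ∈ setsOfSum n ↔ T.Nonempty ∧ ∑ i ∈ T, i = n := by
  simp only [setsOfSum, mem_filter, mem_powerset, and_iff_right_iff_imp]
  rintro ⟨-, h⟩ a ha
  have := single_le_sum (f := fun i : ℕ => i) (fun _ _ => Nat.zero_le _) ha
  simp only [mem_range]
  omega

theorem le_of_mem_of_mem_setsOfSum {n a : ℕ} {T : Finset ℕ} (hT : T ∈ setsOfSum n)
    (ha : a ∈ T) : a ≤ n := by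
  have := single_le_sum (f := fun i : ℕ => i) (fun _ _ => Nat.zero_le _) ha
  have := (mem_setsOfSum.1 hT).2
  omega

theorem sup_id_mem {T : Finset ℕ} (hT : T.Nonempty) : T.sup id ∈ T := by
  obtain ⟨a, ha, h⟩ := T.exists_mem_eq_sup hT id
  rw [h]
  exact ha

theorem le_sup_id {T : Finset ℕ} {a : ℕ} (ha : a ∈ T) : a ≤ T.sup id :=
  le_sup (f := id) ha

theorem sInf_coe_mem {T : Finset ℕ} (hT : T.Nonempty) : sInf (T : Set ℕ) ∈ T := by
  exact_mod_cast Nat.sInf_mem (s := (T : Set ℕ)) (by exact_mod_cast hT)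

theorem sInf_coe_le {T : Finset ℕ} {a : ℕ} (ha : a ∈ T) : sInf (T : Set ℕ) ≤ a :=
  Nat.sInf_le (by exact_mod_cast ha)

/-- Replace the element `a` of `T` by `b`. -/
def swapElem (T : Finset ℕ) (a b : ℕ) : Finset ℕ := insert b (T.erase a)

theorem mem_swapElem {T : Finset ℕ} {a b x : ℕ} :
    x ∈ swapElem T a b ↔ x = b ∨ x ≠ a ∧ x ∈ T := by
  simp [swapElem]

theorem swapElem_nonempty (T : Finset ℕ) (a b : ℕ) : (swapElem T a b).Nonempty :=
  insert_nonempty _ _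

theorem sum_swapElem {T : Finset ℕ} {a b : ℕ} (ha : a ∈ T) (hb : b ∉ T) :
    ∑ i ∈ swapElem T a b, i + a = ∑ i ∈ T, i + b := by
  have := sum_erase_add T (fun i : ℕ => i) ha
  rw [swapElem, sum_insert (by simp [hb])]
  omega

theorem setSign_swapElem {T : Finset ℕ} {a b : ℕ} (ha : a ∈ T) (hb : b ∉ T) :
    setSign (swapElem T a b) = setSign T := by
  rw [setSign, swapElem, card_insert_of_notMem (by simp [hb]), card_erase_add_one ha, setSign]

theorem swapElem_swapElem {T : Finset ℕ} {a b : ℕ} (ha : a ∈ T) (hb : b ∉ T) :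
    swapElem (swapElem T a b) b a = T := by
  ext x
  simp only [mem_swapElem]
  grind

theorem sum_setSign_lt {N n : ℕ} (hN : 0 < N) :
    ∑ T ∈ setsOfSum n with ∀ a ∈ T, a < N, setSign T = if n = 0 then 1 else 0 := by
  split_ifs with h
  · subst h
    have : (setsOfSum 0).filter (fun T => ∀ a ∈ T, a < N) = {{0}} := by
      ext T
      simp only [mem_filter, mem_singleton]
      constructor
      · rintro ⟨hT, -⟩
        exact eq_singleton_iff_nonempty_unique_mem.2 ⟨(mem_setsOfSum.1 hT).1,
          fun a ha => Nat.le_zero.1 (le_of_mem_of_mem_setsOfSum hT ha)⟩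
      · rintro rfl
        simp [mem_setsOfSum, hN]
    simp [this, setSign]
  · refine sum_involution (fun T _ => if 0 ∈ T then T.erase 0 else insert 0 T) ?_ ?_ ?_ ?_
    · intro T _
      split_ifs with h0
      · rw [setSign, setSign, ← card_erase_add_one h0]
        ring
      · rw [setSign, setSign, card_insert_of_notMem h0]
        ring
    · intro T _ _
      split_ifs with h0
      · exact fun hT => by rw [← hT] at h0; simp at h0
      · exact fun hT => h0 (by rw [← hT]; simp)
    · intro T hT
      simp only [mem_filter, mem_setsOfSum] at hT ⊢
      obtain ⟨⟨hne, hsum⟩, hlt⟩ := hT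
      split_ifs with h0
      · have hs := sum_erase_add T (fun i : ℕ => i) h0
        refine ⟨⟨?_, by omega⟩, fun a ha => hlt a (mem_of_mem_erase ha)⟩
        rw [nonempty_iff_ne_empty]
        intro he
        rw [he, sum_empty] at hs
        omega
      · refine ⟨⟨insert_nonempty _ _, by rw [sum_insert h0]; omega⟩, fun a ha => ?_⟩
        rcases mem_insert.1 ha with rfl | ha
        exacts [hN, hlt a ha]
    · intro T _
      split_ifs with h0 h1 h1
      · simp at h1
      · exact insert_erase h0
      · exact erase_insert h0
      · simp at h1

theorem sum_setSign_window_add {N : ℕ} (hN : 0 < N) (n : ℕ) :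
    ∑ T ∈ setsOfSum (n + N) with InWindow N T ∧ ∃ a ∈ T, N ≤ a, setSign T
      = ∑ T ∈ setsOfSum n with InWindow N T, setSign T := by
  have down : ∀ T ∈ (setsOfSum (n + N)).filter (fun T => InWindow N T ∧ ∃ a ∈ T, N ≤ a),
      T.sup id ∈ T ∧ N ≤ T.sup id ∧ T.sup id - N ∉ T ∧ InWindow N T ∧ ∑ i ∈ T, i = n + N := by
    intro T hT
    simp only [mem_filter, mem_setsOfSum] at hT
    obtain ⟨⟨hne, hsum⟩, hw, a, ha, hNa⟩ := hT
    have hM := sup_id_mem hne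
    have hle := le_sup_id ha
    refine ⟨hM, by omega, fun h => ?_, hw, hsum⟩
    have := hw _ hM _ h
    omega
  have up : ∀ T ∈ (setsOfSum n).filter (fun T => InWindow N T),
      sInf (T : Set ℕ) ∈ T ∧ sInf (T : Set ℕ) + N ∉ T ∧ InWindow N T ∧ ∑ i ∈ T, i = n := by
    intro T hT
    simp only [mem_filter, mem_setsOfSum] at hT
    obtain ⟨⟨hne, hsum⟩, hw⟩ := hT
    have hm := sInf_coe_mem hne
    refine ⟨hm, fun h => ?_, hw, hsum⟩
    have := hw _ h _ hm
    omega
  refine sum_bij' (fun T _ => swapElem T (T.sup id) (T.sup id - N))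
    (fun T _ => swapElem T (sInf (T : Set ℕ)) (sInf (T : Set ℕ) + N)) ?_ ?_ ?_ ?_ ?_
  · intro T hT
    obtain ⟨hM, hNM, hnot, hw, hsum⟩ := down T hT
    have hs := sum_swapElem hM hnot
    simp only [mem_filter, mem_setsOfSum]
    refine ⟨⟨swapElem_nonempty _ _ _, by omega⟩, ?_⟩
    intro x hx y hy
    rw [mem_swapElem] at hx hy
    rcases hx with rfl | ⟨hx1, hx⟩ <;> rcases hy with rfl | ⟨hy1, hy⟩
    · omega
    · have := hw _ hM _ hy
      omega
    · have := le_sup_id hx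
      omega
    · exact hw _ hx _ hy
  · intro T hT
    obtain ⟨hm, hnot, hw, hsum⟩ := up T hT
    have hs := sum_swapElem hm hnot
    simp only [mem_filter, mem_setsOfSum]
    refine ⟨⟨swapElem_nonempty _ _ _, by omega⟩, ?_, _, mem_swapElem.2 (Or.inl rfl), by omega⟩
    intro x hx y hy
    rw [mem_swapElem] at hx hy
    rcases hx with rfl | ⟨hx1, hx⟩ <;> rcases hy with rfl | ⟨hy1, hy⟩
    · omega
    · have := sInf_coe_le hy
      omega
    · have := hw _ hx _ hm
      omega
    · exact hw _ hx _ hy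
  · intro T hT
    obtain ⟨hM, hNM, hnot, hw, hsum⟩ := down T hT
    have key : sInf (swapElem T (T.sup id) (T.sup id - N) : Set ℕ) = T.sup id - N := by
      refine le_antisymm (sInf_coe_le (mem_swapElem.2 (Or.inl rfl))) ?_
      rcases mem_swapElem.1 (sInf_coe_mem (swapElem_nonempty T (T.sup id) (T.sup id - N)))
        with h | ⟨-, h⟩
      · exact h.ge
      · have := hw _ hM _ h
        omega
    rw [key, Nat.sub_add_cancel hNM]
    exact swapElem_swapElem hM hnot
  · intro T hT
    obtain ⟨hm, hnot, hw, hsum⟩ := up T hT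
    have key : (swapElem T (sInf (T : Set ℕ)) (sInf (T : Set ℕ) + N)).sup id
        = sInf (T : Set ℕ) + N := by
      refine le_antisymm ?_ (le_sup_id (mem_swapElem.2 (Or.inl rfl)))
      rcases mem_swapElem.1 (sup_id_mem (swapElem_nonempty T (sInf (T : Set ℕ))
        (sInf (T : Set ℕ) + N))) with h | ⟨-, h⟩
      · exact h.le
      · exact (hw _ h _ hm).le
    rw [key, Nat.add_sub_cancel]
    exact swapElem_swapElem hm hnot
  · intro T hT
    obtain ⟨hM, -, hnot, -⟩ := down T hT
    exact (setSign_swapElem hM hnot).symm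

theorem sum_setSign_window_of_lt {N n : ℕ} (h : n < N) :
    ∑ T ∈ setsOfSum n with InWindow N T ∧ ∃ a ∈ T, N ≤ a, setSign T = 0 := by
  rw [filter_false_of_mem, sum_empty]
  rintro T hT ⟨-, a, ha, hNa⟩
  have := le_of_mem_of_mem_setsOfSum hT ha
  omega

theorem sum_setSign_window_split {N n : ℕ} (hN : 0 < N) :
    ∑ T ∈ setsOfSum n with InWindow N T, setSign T
      = ∑ T ∈ setsOfSum n with InWindow N T ∧ ∃ a ∈ T, N ≤ a, setSign T
        + if n = 0 then 1 else 0 := by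
  rw [← sum_setSign_lt hN,
    ← sum_filter_add_sum_filter_not _ (fun T : Finset ℕ => ∃ a ∈ T, N ≤ a),
    filter_filter, filter_filter]
  congr 2
  refine filter_congr fun T _ => ?_
  push Not
  exact ⟨fun h => h.2, fun h => ⟨fun a ha b _ => (h a ha).trans_le (Nat.le_add_left _ _), h⟩⟩

theorem sum_setSign_window {N : ℕ} (hN : 0 < N) (n : ℕ) :
    ∑ T ∈ setsOfSum n with InWindow N T, setSign T = if N ∣ n then 1 else 0 := by
  induction n using Nat.strong_induction_on with
  | _ n ih =>
    rw [sum_setSign_window_split hN]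
    rcases lt_or_ge n N with h | h
    · rw [sum_setSign_window_of_lt h, zero_add]
      have : N ∣ n ↔ n = 0 :=
        ⟨fun hd => Nat.eq_zero_of_dvd_of_lt hd h, fun h0 => h0 ▸ dvd_zero N⟩
      simp [this]
    · obtain ⟨m, rfl⟩ := Nat.exists_eq_add_of_le' h
      rw [sum_setSign_window_add hN, ih m (by omega), if_neg (by omega : m + N ≠ 0)]
      simp

theorem sum_setSign_window_exists_le {N n : ℕ} (hN : 0 < N) (hn : 0 < n) :
    ∑ T ∈ setsOfSum n with InWindow N T ∧ ∃ a ∈ T, N ≤ a, setSign T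
      = if N ∣ n then 1 else 0 := by
  rw [← sum_setSign_window hN, sum_setSign_window_split hN, if_neg hn.ne', add_zero]

theorem card_window_lengths {n : ℕ} {T : Finset ℕ} (hT : T ∈ setsOfSum n) :
    ((Icc 1 n).filter fun N => InWindow N T ∧ ∃ a ∈ T, N ≤ a).card = sInf (T : Set ℕ) := by
  have hne := (mem_setsOfSum.1 hT).1
  have hM := sup_id_mem hne
  have hm := sInf_coe_mem hne
  have hMn := le_of_mem_of_mem_setsOfSum hT hM
  have hmM := le_sup_id hm
  have : ((Icc 1 n).filter fun N => InWindow N T ∧ ∃ a ∈ T, N ≤ a)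
      = Ioc (T.sup id - sInf (T : Set ℕ)) (T.sup id) := by
    ext N
    simp only [mem_filter, mem_Icc, mem_Ioc]
    constructor
    · rintro ⟨-, hw, a, ha, hNa⟩
      have := hw _ hM _ hm
      have := le_sup_id ha
      omega
    · rintro ⟨h1, h2⟩
      refine ⟨by omega, fun a ha b hb => ?_, _, hM, h2⟩
      have := le_sup_id ha
      have := sInf_coe_le hb
      omega
  rw [this, Nat.card_Ioc]
  omega

theorem sum_setSign_mul_sInf {n : ℕ} (hn : 0 < n) :
    ∑ T ∈ setsOfSum n, setSign T * (sInf (T : Set ℕ) : ℕ) = (n.divisors.card : ℤ) := by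
  calc ∑ T ∈ setsOfSum n, setSign T * (sInf (T : Set ℕ) : ℕ)
      = ∑ T ∈ setsOfSum n, ∑ N ∈ Icc 1 n,
          if InWindow N T ∧ ∃ a ∈ T, N ≤ a then setSign T else 0 := by
        refine sum_congr rfl fun T hT => ?_
        rw [← sum_filter, sum_const, card_window_lengths hT, nsmul_eq_mul, mul_comm]
    _ = ∑ N ∈ Icc 1 n, if N ∣ n then 1 else 0 := by
        rw [sum_comm]
        refine sum_congr rfl fun N hN => ?_
        rw [← sum_filter, sum_setSign_window_exists_le (mem_Icc.1 hN).1 hn]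
    _ = (n.divisors.card : ℤ) := by
        rw [sum_boole]
        congr 2

theorem sum_D_eq_sum_setsOfSum {n : ℕ} (hn : 0 < n) :
    ∑ p ∈ D n, (-1 : ℤ) ^ (numParts p - 1) * (smallestPart p : ℤ)
      = ∑ T ∈ setsOfSum n with 0 ∉ T, setSign T * (sInf (T : Set ℕ) : ℕ) := by
  have nodup : ∀ p ∈ D n, p.parts.Nodup := fun p hp => (mem_filter.1 hp).2
  have card_pos : ∀ p : n.Partition, 0 < p.parts.card := by
    intro p
    rw [Multiset.card_pos]
    intro h
    have := p.parts_sum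
    rw [h, Multiset.sum_zero] at this
    omega
  refine sum_bij (fun p _ => p.parts.toFinset) ?_ ?_ ?_ ?_
  · intro p hp
    simp only [mem_filter, mem_setsOfSum]
    refine ⟨⟨?_, ?_⟩, fun h => ?_⟩
    · rw [Multiset.toFinset_nonempty]
      exact Multiset.card_pos.1 (card_pos p)
    · rw [sum_eq_multiset_sum, Multiset.toFinset_val, (nodup p hp).dedup, Multiset.map_id']
      exact p.parts_sum
    · exact (p.parts_pos (Multiset.mem_toFinset.1 h)).ne rfl
  · intro p hp q hq h
    refine Nat.Partition.ext ?_
    rw [← (nodup p hp).dedup, ← (nodup q hq).dedup, ← Multiset.toFinset_val, h,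
      Multiset.toFinset_val]
  · intro T hT
    simp only [mem_filter, mem_setsOfSum] at hT
    obtain ⟨⟨-, hsum⟩, h0⟩ := hT
    refine ⟨⟨T.val, fun {i} hi => Nat.pos_of_ne_zero fun h => h0 (h ▸ hi), ?_⟩, ?_, ?_⟩
    · rw [← hsum, sum_eq_multiset_sum, Multiset.map_id']
    · exact mem_filter.2 ⟨mem_univ _, T.nodup⟩
    · exact T.val_toFinset
  · intro p hp
    have h1 : p.parts.toFinset.card = numParts p :=
      Multiset.toFinset_card_of_nodup (nodup p hp)
    have h2 : ((p.parts.toFinset : Finset ℕ) : Set ℕ) = {j | j ∈ p.parts} := by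
      ext j
      simp
    rw [setSign, h1, h2, smallestPart]
    have h3 : numParts p + 1 = (numParts p - 1) + 2 := by
      have : 0 < numParts p := card_pos p
      omega
    rw [h3, pow_add]
    simp

theorem stmt6 (n : ℕ) (hn : 0 < n) :
    ∑ p ∈ D n, (-1 : ℤ) ^ (numParts p - 1) * (smallestPart p : ℤ)
      = (n.divisors.card : ℤ) := by
  rw [sum_D_eq_sum_setsOfSum hn, ← sum_setSign_mul_sInf hn]
  refine sum_filter_of_ne fun T _ h h0 => h ?_
  rw [Nat.le_zero.1 (sInf_coe_le h0), Nat.cast_zero, mul_zero]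
end

section
/- For every positive integer n, d(n) - 4·d_{2,4}(n) = ∑_{π ∈ P*(n)} (-1)^{#(π)-1} ω(π), where ω(π) := ν(ℓ(π)) · ∏_{i=1}^{ℓ(π)-1} (2ν(i) - 1). -/
open Finset

open scoped Classical

/-- `P*(n)`: partitions of `n` into consecutive integers with smallest part `1`,
i.e. whose set of distinct parts is exactly `{1, 2, …, ℓ(π)}`. -/
def Pstar (n : ℕ) : Finset (n.Partition) :=
  Finset.univ.filter fun p => p.parts.toFinset = Finset.Icc 1 (largestPart p)

/-- The weight `ω(π) = ν(ℓ(π)) · ∏_{i=1}^{ℓ(π)-1} (2ν(i) - 1)`. -/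
def omegaWt {n : ℕ} (p : n.Partition) : ℤ :=
  (mult p (largestPart p) : ℤ) *
    ∏ i ∈ Finset.Icc 1 (largestPart p - 1), (2 * (mult p i : ℤ) - 1)

section QSeries

variable {A : Type*} [CommRing A]

/-- The shifted `q`-factorial `(1 - q ^ n) (1 - q ^ (n - 1)) ⋯ (1 - q ^ (n - k + 1))`, which
vanishes for `n < k`. -/
def qDescProd (q : A) (k n : ℕ) : A := ∏ i ∈ range k, (1 - q ^ (n - i))

/-- The quotient `(q; q)_k / (-q; q)_k`, where `w i` stands for the inverse of `1 + q ^ i`. -/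
def qPochRatio (q : A) (w : ℕ → A) (k : ℕ) : A := ∏ i ∈ range k, (1 - q ^ (i + 1)) * w (i + 1)

/-- The product of `- q ^ i / (1 + q ^ i)` over `j < i ≤ j + n`, where `w i` stands for the
inverse of `1 + q ^ i`. -/
def qShiftProd (q : A) (w : ℕ → A) (j n : ℕ) : A :=
  ∏ i ∈ range n, (-q ^ (j + i + 1) * w (j + i + 1))

lemma qDescProd_succ (q : A) (k n : ℕ) :
    qDescProd q (k + 1) n = qDescProd q k n * (1 - q ^ (n - k)) :=
  prod_range_succ _ _

lemma qDescProd_succ_succ (q : A) (k n : ℕ) :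
    qDescProd q (k + 1) (n + 1) = (1 - q ^ (n + 1)) * qDescProd q k n := by
  simp [qDescProd, prod_range_succ', mul_comm]

lemma qDescProd_of_lt (q : A) {k n : ℕ} (h : n < k) : qDescProd q k n = 0 :=
  prod_eq_zero (mem_range.2 h) (by simp)

lemma pow_mul_qDescProd_succ (q : A) (k n : ℕ) :
    q ^ k * qDescProd q (k + 1) n = qDescProd q k n * (q ^ k - q ^ n) := by
  rcases lt_or_ge n k with h | h
  · simp [qDescProd_of_lt q h, qDescProd_of_lt q (h.trans k.lt_succ_self)]
  · obtain ⟨m, rfl⟩ := Nat.exists_eq_add_of_le h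
    rw [qDescProd_succ, Nat.add_sub_cancel_left]
    ring

lemma qDescProd_pascal (q : A) (k n : ℕ) :
    qDescProd q (k + 1) (n + 1) =
      q ^ (k + 1) * qDescProd q (k + 1) n + (1 - q ^ (k + 1)) * qDescProd q k n := by
  have h := pow_mul_qDescProd_succ q k n
  rw [qDescProd_succ_succ]
  linear_combination (-q) * h

lemma sum_pow_mul_qDescProd_succ (q B : A) {M : ℕ} (hB : B ^ M = 0) (k : ℕ) :
    (1 - B * q ^ (k + 1)) * ∑ n ∈ range M, B ^ n * qDescProd q (k + 1) n =
      B * (1 - q ^ (k + 1)) * ∑ n ∈ range M, B ^ n * qDescProd q k n := by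
  have h : ∑ n ∈ range M, B ^ n * qDescProd q (k + 1) n =
      ∑ n ∈ range M, B ^ (n + 1) * qDescProd q (k + 1) (n + 1) := by
    have h₁ := sum_range_succ (fun n => B ^ n * qDescProd q (k + 1) n) M
    have h₂ := sum_range_succ' (fun n => B ^ n * qDescProd q (k + 1) n) M
    rw [qDescProd_of_lt q k.succ_pos] at h₂
    rw [hB] at h₁
    linear_combination h₂ - h₁
  have h' : ∑ n ∈ range M, B ^ (n + 1) * qDescProd q (k + 1) (n + 1) =
      B * q ^ (k + 1) * ∑ n ∈ range M, B ^ n * qDescProd q (k + 1) n +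
        B * (1 - q ^ (k + 1)) * ∑ n ∈ range M, B ^ n * qDescProd q k n := by
    rw [mul_sum, mul_sum, ← sum_add_distrib]
    refine sum_congr rfl fun n _ => ?_
    rw [qDescProd_pascal]
    ring
  linear_combination h + h'

variable {q : A} {w : ℕ → A}

lemma qShiftProd_succ_left (hw : ∀ i, (1 + q ^ (i + 1)) * w (i + 1) = 1) (j n : ℕ) :
    qShiftProd q w (j + 1) n =
      qShiftProd q w j n * (q ^ n * (1 + q ^ (j + 1)) * w (j + n + 1)) := by
  induction n with
  | zero => simp [qShiftProd, hw]
  | succ n ih =>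
    rw [qShiftProd, prod_range_succ, ← qShiftProd, ih, qShiftProd, qShiftProd, prod_range_succ,
      show j + 1 + n + 1 = j + (n + 1) + 1 by ring]
    ring

lemma qShiftProd_sub (hw : ∀ i, (1 + q ^ (i + 1)) * w (i + 1) = 1) (j n : ℕ) :
    qShiftProd q w j n - qShiftProd q w (j + 1) n =
      qShiftProd q w j n * w (j + n + 1) * (1 - q ^ n) := by
  rw [qShiftProd_succ_left hw]
  linear_combination (-qShiftProd q w j n) * hw (j + n)

lemma neg_pow_pow_eq_zero {M : ℕ} (hq : q ^ M = 0) (j : ℕ) : (-q ^ (j + 1)) ^ M = 0 := by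
  rw [neg_pow, ← pow_mul, mul_comm (j + 1), pow_mul, hq]
  simp

lemma sum_geom_eq_inv (hw : ∀ i, (1 + q ^ (i + 1)) * w (i + 1) = 1) {M : ℕ} (hq : q ^ M = 0)
    (j : ℕ) : ∑ n ∈ range M, (-q ^ (j + 1)) ^ n = w (j + 1) := by
  have h := mul_neg_geom_sum (-q ^ (j + 1)) M
  rw [neg_pow_pow_eq_zero hq] at h
  linear_combination w (j + 1) * h - (∑ n ∈ range M, (-q ^ (j + 1)) ^ n) * hw j

lemma sum_range_succ_of_pow_eq_zero {B : A} {M : ℕ} (hB : B ^ M = 0) (f : ℕ → A) :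
    ∑ n ∈ range M, B ^ n * f n = f 0 + ∑ n ∈ range M, B ^ (n + 1) * f (n + 1) := by
  have h₁ := sum_range_succ (fun n => B ^ n * f n) M
  have h₂ := sum_range_succ' (fun n => B ^ n * f n) M
  simp only [hB, pow_zero] at h₁ h₂
  linear_combination h₂ - h₁

/-- The summand `(q; q)_n / (-q; q)_n` times the shifted product and `1 / (1 + q ^ (j + n + 1))`. -/
def qTerm (q : A) (w : ℕ → A) (j n : ℕ) : A :=
  qPochRatio q w n * qShiftProd q w j n * w (j + n + 1)

lemma qTerm_succ (j k : ℕ) :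
    qTerm q w j (k + 1) =
      qTerm q w j k * ((1 - q ^ (k + 1)) * w (k + 1) * -q ^ (j + k + 1) * w (j + k + 2)) := by
  simp only [qTerm, qPochRatio, qShiftProd, prod_range_succ]
  ring_nf

lemma qTerm_eq_sum (hw : ∀ i, (1 + q ^ (i + 1)) * w (i + 1) = 1) {M : ℕ} (hq : q ^ M = 0)
    (j k : ℕ) :
    qTerm q w j (k + 1) = (∏ i ∈ range k, q ^ (i + 1) * w (i + 1)) * w (k + 1) *
      ∑ n ∈ range M, (-q ^ (j + 1)) ^ n * qDescProd q (k + 1) n := by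
  have hV : ∀ k, ∑ n ∈ range M, (-q ^ (j + 1)) ^ n * qDescProd q (k + 1) n =
      -q ^ (j + 1) * (1 - q ^ (k + 1)) * w (j + k + 2) *
        ∑ n ∈ range M, (-q ^ (j + 1)) ^ n * qDescProd q k n := by
    intro k
    have h := sum_pow_mul_qDescProd_succ q (-q ^ (j + 1)) (neg_pow_pow_eq_zero hq j) k
    have h' : (1 - -q ^ (j + 1) * q ^ (k + 1)) * w (j + k + 2) = 1 := by
      have := hw (j + k + 1)
      rw [show j + k + 1 + 1 = j + k + 2 from rfl] at this
      linear_combination this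
    linear_combination w (j + k + 2) * h -
      (∑ n ∈ range M, (-q ^ (j + 1)) ^ n * qDescProd q (k + 1) n) * h'
  induction k with
  | zero =>
    have h0 : ∑ n ∈ range M, (-q ^ (j + 1)) ^ n * qDescProd q 0 n = w (j + 1) := by
      rw [← sum_geom_eq_inv hw hq]
      simp [qDescProd]
    rw [hV, h0]
    simp [qTerm, qPochRatio, qShiftProd]
    ring
  | succ k ih =>
    rw [qTerm_succ, ih, hV (k + 1), prod_range_succ]
    ring_nf

lemma one_add_two_mul_sum_eq (hw : ∀ i, (1 + q ^ (i + 1)) * w (i + 1) = 1) {M : ℕ}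
    (hq : q ^ M = 0) (j K : ℕ) :
    1 + 2 * ∑ n ∈ range M, (-q ^ (j + 1)) ^ (n + 1) * w (n + 1) =
      ∑ k ∈ range (K + 1), qTerm q w j k +
        (∏ i ∈ range K, q ^ (i + 1) * w (i + 1)) *
          ∑ n ∈ range M, (-q ^ (j + 1)) ^ n * qDescProd q (K + 1) n * w n := by
  induction K with
  | zero =>
    have hB := neg_pow_pow_eq_zero hq j
    have h₁ := sum_geom_eq_inv hw hq j
    have h₂ := sum_range_succ_of_pow_eq_zero hB (fun _ => 1)
    have h₃ := sum_range_succ_of_pow_eq_zero hB (fun n => qDescProd q 1 n * w n)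
    simp only [mul_one] at h₂
    simp only [← mul_assoc] at h₃
    rw [zero_add, range_one, sum_singleton, range_zero, prod_empty, one_mul, h₃,
      qDescProd_of_lt q one_pos, qTerm]
    simp only [qPochRatio, qShiftProd, range_zero, prod_empty, add_zero, one_mul, ← h₁, h₂,
      zero_mul, zero_add]
    rw [add_assoc, ← sum_add_distrib, mul_sum]
    congr 1
    refine sum_congr rfl fun n _ => ?_
    simp only [qDescProd, range_one, prod_singleton, Nat.sub_zero]
    linear_combination (-q ^ (j + 1)) ^ (n + 1) * hw n
  | succ K ih =>
    rw [ih, sum_range_succ _ (K + 1), qTerm_eq_sum hw hq, add_assoc, prod_range_succ, mul_assoc,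
      mul_assoc, ← mul_add]
    congr 2
    rw [mul_sum, mul_sum, ← sum_add_distrib]
    refine sum_congr rfl fun n _ => ?_
    rcases n.eq_zero_or_pos with rfl | hn
    · simp [qDescProd_of_lt]
    obtain ⟨n, rfl⟩ := Nat.exists_eq_succ_of_ne_zero hn.ne'
    have h := pow_mul_qDescProd_succ q (K + 1) (n + 1)
    simp only [Nat.succ_eq_add_one]
    set d := qDescProd q (K + 1) (n + 1)
    set B := (-q ^ (j + 1)) ^ (n + 1)
    linear_combination (-B * w (K + 1) * w (n + 1)) * h + B * d * w (K + 1) * hw n -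
      B * d * w (n + 1) * hw K

/-- A terminating form of the transformation turning the alternating `q`-series with summands
`q ^ (L (L + 1) / 2) (q; q)_{L - 1} / (-q; q)_L ^ 2` into a double Lambert series. -/
lemma sum_qPochRatio_mul_qShiftProd (hw : ∀ i, (1 + q ^ (i + 1)) * w (i + 1) = 1) {M : ℕ}
    (hq : q ^ M = 0) :
    ∑ L ∈ range M, -(qPochRatio q w L * w (L + 1) * qShiftProd q w 0 (L + 1)) =
      ∑ j ∈ range M,
        (w (j + 1) - 1 - 2 * ∑ n ∈ range M, (-q ^ (j + 1)) ^ (n + 1) * w (n + 1)) := by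
  set S : ℕ → A := fun j =>
    ∑ L ∈ range M, -(qPochRatio q w L * w (L + 1) * qShiftProd q w j (L + 1)) with hS
  have hpow : ∀ m, M ≤ m → q ^ m = 0 := fun m hm => pow_eq_zero_of_le hm hq
  have hlast : S M = 0 := by
    refine sum_eq_zero fun L _ => ?_
    rw [qShiftProd, prod_eq_zero (mem_range.2 L.succ_pos)]
    · simp
    · rw [hpow _ (by omega)]
      simp
  have hstep : ∀ j, S j - S (j + 1) =
      w (j + 1) - 1 - 2 * ∑ n ∈ range M, (-q ^ (j + 1)) ^ (n + 1) * w (n + 1) := by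
    intro j
    have hrem : (∏ i ∈ range M, q ^ (i + 1) * w (i + 1)) *
        ∑ n ∈ range M, (-q ^ (j + 1)) ^ n * qDescProd q (M + 1) n * w n = 0 := by
      rw [sum_eq_zero, mul_zero]
      intro n hn
      rw [qDescProd_of_lt q (by have := mem_range.1 hn; omega)]
      simp
    have h := one_add_two_mul_sum_eq hw hq j M
    rw [hrem, add_zero, sum_range_succ'] at h
    have h0 : qTerm q w j 0 = w (j + 1) := by simp [qTerm, qPochRatio, qShiftProd]
    have hdiff : S j - S (j + 1) = -∑ L ∈ range M, qTerm q w j (L + 1) := by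
      simp only [hS]
      rw [← sum_sub_distrib, ← sum_neg_distrib]
      refine sum_congr rfl fun L _ => ?_
      have := qShiftProd_sub hw j (L + 1)
      simp only [qTerm, qPochRatio, prod_range_succ] at this ⊢
      linear_combination (-(∏ i ∈ range L, (1 - q ^ (i + 1)) * w (i + 1)) * w (L + 1)) * this
    rw [hdiff]
    linear_combination h + h0
  rw [← sum_congr rfl fun j _ => hstep j, sum_range_sub', hlast, sub_zero]

end QSeries

section Partitions

open PowerSeries

/-- The power series `∑ ν, g ν X ^ (i ν)`. -/
noncomputable def dilatedSeries (i : ℕ) (g : ℕ → ℤ) : ℤ⟦X⟧ :=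
  PowerSeries.mk fun m => if i ∣ m then g (m / i) else 0

lemma mem_Pstar {n : ℕ} {p : n.Partition} :
    p ∈ Pstar n ↔ p.parts.toFinset = Icc 1 (largestPart p) := by
  simp [Pstar]

lemma largestPart_eq_of_toFinset_eq {n L : ℕ} {p : n.Partition}
    (h : p.parts.toFinset = Icc 1 L) : largestPart p = L := by
  rw [largestPart, h]
  refine le_antisymm (Finset.sup_le fun i hi => (mem_Icc.1 hi).2) ?_
  rcases L.eq_zero_or_pos with rfl | hL
  · exact Nat.zero_le _
  · exact le_sup (f := id) (mem_Icc.2 ⟨hL, le_rfl⟩)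

lemma largestPart_mem_Icc {n : ℕ} (hn : 0 < n) (p : n.Partition) :
    largestPart p ∈ Icc 1 n := by
  refine mem_Icc.2 ⟨?_, Finset.sup_le fun i hi => ?_⟩
  · obtain ⟨i, hi⟩ : ∃ i, i ∈ p.parts := by
      refine Multiset.exists_mem_of_ne_zero fun h => hn.ne ?_
      rw [← p.parts_sum, h, Multiset.sum_zero]
    exact (p.parts_pos hi).trans_le (le_sup (f := id) (Multiset.mem_toFinset.2 hi))
  · exact p.le_of_mem_parts (Multiset.mem_toFinset.1 hi)

lemma toFinsuppAntidiag_apply {n : ℕ} (p : n.Partition) (i : ℕ) :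
    p.toFinsuppAntidiag i = mult p i * i := rfl

lemma support_toFinsuppAntidiag {n : ℕ} (p : n.Partition) :
    p.toFinsuppAntidiag.support = p.parts.toFinset := rfl

lemma exists_partition_toFinsuppAntidiag_eq {n L : ℕ} {l : ℕ →₀ ℕ}
    (hl : l ∈ finsuppAntidiag (Icc 1 L) n) (h : ∀ i ∈ Icc 1 L, i ∣ l i ∧ l i ≠ 0) :
    ∃ p : n.Partition, p.parts.toFinset = Icc 1 L ∧ p.toFinsuppAntidiag = l := by
  obtain ⟨hsum, hsupp⟩ := mem_finsuppAntidiag.1 hl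
  have hsupp' : l.support = Icc 1 L :=
    hsupp.antisymm fun i hi => Finsupp.mem_support_iff.2 (h i hi).2
  have hmul : ∀ i, l i / i * i = l i := fun i => by
    by_cases hi : i ∈ Icc 1 L
    · exact Nat.div_mul_cancel (h i hi).1
    · have : l i = 0 := by
        rw [← hsupp'] at hi
        exact Finsupp.notMem_support_iff.1 hi
      simp [this]
  let f : ℕ →₀ ℕ := Finsupp.mk l.support (fun i => l i / i) fun i => by
    have := hmul i
    rw [Finsupp.mem_support_iff]
    refine not_congr ⟨fun h0 => by simp [h0], fun h0 => by rw [← this, h0, zero_mul]⟩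
  refine ⟨⟨f.toMultiset, fun {i} hi => ?_, ?_⟩, ?_, ?_⟩
  · rw [Finsupp.mem_toMultiset] at hi
    exact (mem_Icc.1 (hsupp hi)).1
  · rw [Finsupp.sum_toMultiset, ← hsum, ← hsupp']
    exact sum_congr rfl fun i _ => hmul i
  · rw [Finsupp.toFinset_toMultiset]
    exact hsupp'
  · ext i
    rw [toFinsuppAntidiag_apply, mult, Finsupp.count_toMultiset]
    exact hmul i

lemma toFinsuppAntidiag_mem_of_toFinset_eq {n : ℕ} {p : n.Partition} {s : Finset ℕ}
    (h : p.parts.toFinset = s) : p.toFinsuppAntidiag ∈ finsuppAntidiag s n := by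
  obtain ⟨hsum, hsupp⟩ := mem_finsuppAntidiag.1 p.toFinsuppAntidiag_mem_finsuppAntidiag
  rw [← h, ← support_toFinsuppAntidiag]
  refine mem_finsuppAntidiag.2 ⟨?_, subset_rfl⟩
  exact (sum_subset hsupp fun i _ hi => Finsupp.notMem_support_iff.1 hi).trans hsum

/-- The coefficients of a product of dilated series enumerate the partitions whose set of distinct
parts is `{1, …, L}`. -/
lemma sum_Pstar_prod_eq_coeff (n L : ℕ) (g : ℕ → ℕ → ℤ) (hg : ∀ i, g i 0 = 0) :
    ∑ p ∈ Pstar n with largestPart p = L, ∏ i ∈ Icc 1 L, g i (mult p i) =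
      coeff n (∏ i ∈ Icc 1 L, dilatedSeries i (g i)) := by
  have hmem : ∀ p : n.Partition,
      p ∈ (Pstar n).filter (fun p => largestPart p = L) ↔ p.parts.toFinset = Icc 1 L := by
    intro p
    rw [mem_filter, mem_Pstar]
    constructor
    · rintro ⟨h, rfl⟩
      exact h
    · intro h
      rw [largestPart_eq_of_toFinset_eq h]
      exact ⟨h, rfl⟩
  rw [coeff_prod]
  refine sum_of_injOn Nat.Partition.toFinsuppAntidiag
    (Nat.Partition.toFinsuppAntidiag_injective n).injOn ?_ ?_ ?_
  · intro p hp
    exact toFinsuppAntidiag_mem_of_toFinset_eq ((hmem p).1 hp)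
  · intro l hl hl'
    by_contra hne
    refine hl' ?_
    obtain ⟨p, hp, rfl⟩ := exists_partition_toFinsuppAntidiag_eq hl fun i hi => by
      have := prod_ne_zero_iff.1 hne i hi
      rw [dilatedSeries, coeff_mk] at this
      refine ⟨by_contra fun h => this (if_neg h), fun h => this ?_⟩
      simp [h, hg]
    exact ⟨p, (hmem p).2 hp, rfl⟩
  · intro p _
    refine prod_congr rfl fun i hi => ?_
    rw [toFinsuppAntidiag_apply, dilatedSeries, coeff_mk, if_pos (dvd_mul_left _ _),
      Nat.mul_div_cancel _ (mem_Icc.1 hi).1]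

/-- The signed weight `(-1) ^ ν (2ν - 1)` of a part other than the largest one, which occurs
`ν ≥ 1` times. -/
def innerWt (ν : ℕ) : ℤ := if ν = 0 then 0 else (-1) ^ ν * (2 * ν - 1)

/-- The signed weight `(-1) ^ ν ν` of the largest part, which occurs `ν` times. -/
def lastWt (ν : ℕ) : ℤ := (-1) ^ ν * ν

lemma signed_omegaWt_eq {n L : ℕ} {p : n.Partition} (h : p.parts.toFinset = Icc 1 (L + 1)) :
    (-1 : ℤ) ^ (numParts p - 1) * omegaWt p =
      -∏ i ∈ Icc 1 (L + 1), (if i = L + 1 then lastWt else innerWt) (mult p i) := by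
  have hcount : ∀ i ∈ Icc 1 (L + 1), mult p i ≠ 0 := by
    intro i hi
    rw [← h, Multiset.mem_toFinset] at hi
    exact (Multiset.count_pos.2 hi).ne'
  have hcard : numParts p = ∑ i ∈ Icc 1 (L + 1), mult p i := by
    rw [← h]
    exact (Multiset.toFinset_sum_count_eq _).symm
  have hpos : 1 ≤ numParts p := by
    rw [hcard]
    exact (Nat.pos_of_ne_zero (hcount 1 (by simp))).trans_le
      (single_le_sum (f := mult p) (fun _ _ => Nat.zero_le _) (by simp))
  have hsign : (-1 : ℤ) ^ (numParts p - 1) = -∏ i ∈ Icc 1 (L + 1), (-1 : ℤ) ^ mult p i := by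
    rw [prod_pow_eq_pow_sum, ← hcard]
    obtain ⟨m, hm⟩ := Nat.exists_eq_add_of_le' hpos
    rw [hm, Nat.add_sub_cancel, pow_succ]
    ring
  have hprod : ∏ i ∈ Icc 1 L, (if i = L + 1 then lastWt else innerWt) (mult p i) =
      (∏ i ∈ Icc 1 L, (-1 : ℤ) ^ mult p i) * ∏ i ∈ Icc 1 L, (2 * (mult p i : ℤ) - 1) := by
    rw [← prod_mul_distrib]
    refine prod_congr rfl fun i hi => ?_
    obtain ⟨h₁, h₂⟩ := mem_Icc.1 hi
    rw [if_neg (by omega), innerWt, if_neg (hcount i (mem_Icc.2 ⟨h₁, by omega⟩))]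
  rw [hsign, omegaWt, largestPart_eq_of_toFinset_eq h, Nat.add_sub_cancel,
    prod_Icc_succ_top (by omega), prod_Icc_succ_top (by omega), hprod, if_pos rfl, lastWt]
  ring

lemma sum_Pstar_signed_omegaWt {n : ℕ} (hn : 0 < n) :
    ∑ p ∈ Pstar n, (-1 : ℤ) ^ (numParts p - 1) * omegaWt p =
      coeff n (∑ L ∈ range (n + 1), -((∏ i ∈ range L, dilatedSeries (i + 1) innerWt) *
        dilatedSeries (L + 1) lastWt)) := by
  have hmaps : ∀ p ∈ Pstar n, largestPart p - 1 ∈ range (n + 1) := by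
    intro p _
    have := mem_Icc.1 (largestPart_mem_Icc hn p)
    exact mem_range.2 (by omega)
  rw [← sum_fiberwise_of_maps_to hmaps, map_sum]
  refine sum_congr rfl fun L _ => ?_
  have hprod : (∏ i ∈ range L, dilatedSeries (i + 1) innerWt) * dilatedSeries (L + 1) lastWt =
      ∏ i ∈ Icc 1 (L + 1), dilatedSeries i (if i = L + 1 then lastWt else innerWt) := by
    rw [prod_Icc_succ_top (by omega), if_pos rfl, range_eq_Ico,
      prod_Ico_add' (fun i => dilatedSeries i innerWt) 0 L 1]
    congr 1
    refine prod_congr rfl fun i hi => ?_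
    have := mem_Ico.1 hi
    rw [if_neg (by omega)]
  rw [hprod, map_neg, ← sum_Pstar_prod_eq_coeff n (L + 1)
    (fun i => if i = L + 1 then lastWt else innerWt), ← sum_neg_distrib]
  · have hfilter : (Pstar n).filter (fun p => largestPart p - 1 = L) =
        (Pstar n).filter (fun p => largestPart p = L + 1) := by
      refine filter_congr fun p _ => ?_
      have := mem_Icc.1 (largestPart_mem_Icc hn p)
      omega
    rw [hfilter]
    refine sum_congr rfl fun p hp => signed_omegaWt_eq ?_
    obtain ⟨hp, hL⟩ := mem_filter.1 hp
    rw [mem_Pstar.1 hp, hL]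
  · intro i
    split_ifs <;> simp [lastWt, innerWt]

end Partitions

section Divisors

/-- The coefficient of `X ^ (a b)` in the double Lambert series. -/
def lambertWt (a b : ℕ) : ℤ := (-1) ^ b - 2 * (if Odd b then (-1) ^ a else 0)

lemma lambertWt_eq (a b : ℕ) : lambertWt a b = 1 - 4 * (if Even a ∧ Odd b then 1 else 0) := by
  rcases Nat.even_or_odd a with ha | ha <;> rcases Nat.even_or_odd b with hb | hb
  · simp [lambertWt, hb, Nat.not_odd_iff_even.2 hb]
  · simp [lambertWt, ha, hb, hb.neg_one_pow]
  · simp [lambertWt, hb, Nat.not_odd_iff_even.2 hb]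
  · simp [lambertWt, ha.neg_one_pow, hb, hb.neg_one_pow, Nat.not_even_iff_odd.2 ha]

lemma card_divisorsAntidiagonal_even_odd (n : ℕ) :
    #{x ∈ n.divisorsAntidiagonal | Even x.1 ∧ Odd x.2} = #{d ∈ n.divisors | d % 4 = 2} := by
  refine card_bij (fun x _ => 2 * x.2) ?_ ?_ ?_
  · rintro ⟨a, b⟩ h
    simp only [mem_filter, Nat.mem_divisorsAntidiagonal, Nat.mem_divisors] at h ⊢
    obtain ⟨⟨h, hn⟩, ⟨c, rfl⟩, ⟨d, rfl⟩⟩ := h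
    exact ⟨⟨⟨c, by rw [← h]; ring⟩, hn⟩, by omega⟩
  · rintro ⟨a, b⟩ h ⟨c, d⟩ h' heq
    simp only [mem_filter, Nat.mem_divisorsAntidiagonal] at h h'
    obtain rfl : b = d := by simpa using heq
    have : a * b = c * b := h.1.1.trans h'.1.1.symm
    rw [Nat.eq_of_mul_eq_mul_right h.2.2.pos this]
  · intro d hd
    simp only [mem_filter, Nat.mem_divisors] at hd
    obtain ⟨⟨⟨c, rfl⟩, hn⟩, hd⟩ := hd
    refine ⟨(2 * c, d / 2), ?_, by simp only; omega⟩
    simp only [mem_filter, Nat.mem_divisorsAntidiagonal]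
    refine ⟨⟨?_, hn⟩, even_two_mul c, Nat.odd_iff.2 (by omega)⟩
    obtain ⟨e, rfl⟩ : 2 ∣ d := by omega
    rw [Nat.mul_div_cancel_left _ two_pos]
    ring

lemma sum_lambertWt (n : ℕ) :
    ∑ x ∈ n.divisorsAntidiagonal, lambertWt x.1 x.2 =
      (#n.divisors : ℤ) - 4 * (#{d ∈ n.divisors | d % 4 = 2} : ℤ) := by
  simp only [lambertWt_eq]
  rw [sum_sub_distrib, ← mul_sum, sum_boole, card_divisorsAntidiagonal_even_odd, sum_const,
    ← Nat.map_div_right_divisors, card_map]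
  simp

end Divisors

section Truncation

open PowerSeries

lemma one_add_sq_mul_sum_lastWt {A : Type*} [CommRing A] {x : A} {M : ℕ} (hx : x ^ M = 0) :
    (1 + x) ^ 2 * ∑ ν ∈ range M, (lastWt ν : A) * x ^ ν = -x := by
  have h : ∀ m : ℕ, (1 + x) ^ 2 * ∑ ν ∈ range m, (lastWt ν : A) * x ^ ν =
      -x - (-x) ^ m * (m * (1 + x) - x) := by
    intro m
    induction m with
    | zero => simp
    | succ m ih =>
      rw [sum_range_succ, mul_add, ih, lastWt]
      push_cast
      rw [neg_pow x m, neg_pow x (m + 1)]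
      ring
  rw [h, neg_pow, hx]
  ring

lemma one_add_sq_mul_sum_innerWt {A : Type*} [CommRing A] {x : A} {M : ℕ} (hx : x ^ M = 0) :
    (1 + x) ^ 2 * ∑ ν ∈ range M, (innerWt ν : A) * x ^ ν = -x * (1 - x) := by
  have h : ∀ m : ℕ, (1 + x) ^ 2 * ∑ ν ∈ range (m + 1), (innerWt ν : A) * x ^ ν =
      -x * (1 - x) - (-x) ^ (m + 1) * ((2 * m + 1) * (1 + x) - 2 * x) := by
    intro m
    induction m with
    | zero =>
      simp [innerWt]
      ring
    | succ m ih =>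
      rw [sum_range_succ, mul_add, ih, innerWt, if_neg m.succ_ne_zero]
      push_cast
      rw [neg_pow x (m + 1), neg_pow x (m + 1 + 1)]
      ring
  rcases M with _ | M
  · have : (1 : A) = 0 := by simpa using hx
    have : Subsingleton A := subsingleton_of_zero_eq_one this.symm
    exact Subsingleton.elim _ _
  · rw [h, neg_pow, hx]
    ring

lemma mk_dilatedSeries (M : ℕ) {i : ℕ} (hi : 0 < i) (g : ℕ → ℤ) :
    Ideal.Quotient.mk (Ideal.span {(X : ℤ⟦X⟧) ^ M}) (dilatedSeries i g) =
      ∑ ν ∈ range M, (g ν : ℤ⟦X⟧ ⧸ Ideal.span {(X : ℤ⟦X⟧) ^ M}) *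
        (Ideal.Quotient.mk (Ideal.span {(X : ℤ⟦X⟧) ^ M}) X ^ i) ^ ν := by
  have h : ∑ ν ∈ range M, (g ν : ℤ⟦X⟧ ⧸ Ideal.span {(X : ℤ⟦X⟧) ^ M}) *
      (Ideal.Quotient.mk (Ideal.span {(X : ℤ⟦X⟧) ^ M}) X ^ i) ^ ν =
        Ideal.Quotient.mk _ (∑ ν ∈ range M, C (g ν) * X ^ (i * ν)) := by
    rw [map_sum]
    refine sum_congr rfl fun ν _ => ?_
    rw [map_mul, map_pow, ← pow_mul, ← map_intCast (Ideal.Quotient.mk (Ideal.span {(X : ℤ⟦X⟧) ^ M}))]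
    simp
  rw [h, Ideal.Quotient.eq, Ideal.mem_span_singleton, X_pow_dvd_iff]
  intro m hm
  rw [map_sub, map_sum, dilatedSeries, coeff_mk, sub_eq_zero]
  simp only [coeff_C_mul, coeff_X_pow, mul_ite, mul_one, mul_zero]
  split_ifs with hdvd
  · obtain ⟨k, rfl⟩ := hdvd
    have hk : k < M := (Nat.le_mul_of_pos_left k hi).trans_lt hm
    rw [Nat.mul_div_cancel_left _ hi]
    simp [hi.ne', hk]
  · refine (sum_eq_zero fun ν _ => if_neg ?_).symm
    rintro rfl
    exact hdvd (dvd_mul_right _ _)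

lemma inv_mul_sum_pow {A : Type*} [CommRing A] {x v : A} (hv : (1 + x) * v = 1) {M : ℕ}
    (hx : x ^ M = 0) :
    v * ∑ j ∈ range M, x ^ (j + 1) = ∑ s ∈ range M, if Odd (s + 1) then x ^ (s + 1) else 0 := by
  have h : ∀ m : ℕ, (1 + x) * (∑ s ∈ range m, if Odd (s + 1) then x ^ (s + 1) else 0) =
      ∑ j ∈ range m, x ^ (j + 1) + if Odd m then x ^ (m + 1) else 0 := by
    intro m
    induction m with
    | zero => simp
    | succ m ih =>
      rw [sum_range_succ, sum_range_succ, mul_add, ih]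
      by_cases hm : Odd m <;> simp [hm, Nat.odd_add_one]; ring
  have h' := h M
  rw [pow_succ, hx, zero_mul, ite_self, add_zero] at h'
  rw [← h', ← mul_assoc, mul_comm v, hv, one_mul]

/-- Expansion of the double Lambert series in powers of `q`. -/
lemma sum_inv_sub_eq_sum_lambertWt {A : Type*} [CommRing A] {q : A} {w : ℕ → A}
    (hw : ∀ i, (1 + q ^ (i + 1)) * w (i + 1) = 1) {M : ℕ} (hq : q ^ M = 0) :
    ∑ j ∈ range M,
        (w (j + 1) - 1 - 2 * ∑ n ∈ range M, (-q ^ (j + 1)) ^ (n + 1) * w (n + 1)) =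
      ∑ a ∈ range M, ∑ b ∈ range M,
        (lambertWt (a + 1) (b + 1) : A) * q ^ ((a + 1) * (b + 1)) := by
  have h₁ : ∀ j, w (j + 1) - 1 = ∑ k ∈ range M, (-1) ^ (k + 1) * q ^ ((j + 1) * (k + 1)) := by
    intro j
    have h := sum_range_succ_of_pow_eq_zero (neg_pow_pow_eq_zero hq j) (fun _ => 1)
    simp only [mul_one] at h
    rw [← sum_geom_eq_inv hw hq, h, add_sub_cancel_left]
    refine sum_congr rfl fun k _ => ?_
    rw [neg_pow, pow_mul]
  have h₂ : ∑ j ∈ range M, ∑ n ∈ range M, (-q ^ (j + 1)) ^ (n + 1) * w (n + 1) =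
      ∑ n ∈ range M, ∑ s ∈ range M,
        (-1) ^ (n + 1) * if Odd (s + 1) then q ^ ((n + 1) * (s + 1)) else 0 := by
    rw [sum_comm]
    refine sum_congr rfl fun n _ => ?_
    have hx : (q ^ (n + 1)) ^ M = 0 := by
      rw [← pow_mul, mul_comm, pow_mul, hq, zero_pow n.succ_ne_zero]
    simp only [pow_mul, ← mul_sum]
    rw [← inv_mul_sum_pow (hw n) hx, mul_sum, mul_sum]
    refine sum_congr rfl fun j _ => ?_
    rw [neg_pow, ← pow_mul, ← pow_mul, mul_comm (j + 1)]
    ring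
  rw [sum_sub_distrib, ← mul_sum, h₂, sum_congr rfl fun j _ => h₁ j, mul_sum, ← sum_sub_distrib]
  refine sum_congr rfl fun a _ => ?_
  rw [mul_sum, ← sum_sub_distrib]
  refine sum_congr rfl fun b _ => ?_
  rw [lambertWt]
  split_ifs <;> push_cast <;> ring

lemma coeff_sum_lambertWt {n : ℕ} (hn : 0 < n) :
    coeff n (∑ a ∈ range (n + 1), ∑ b ∈ range (n + 1),
      C (lambertWt (a + 1) (b + 1)) * (X : ℤ⟦X⟧) ^ ((a + 1) * (b + 1))) =
      ∑ x ∈ n.divisorsAntidiagonal, lambertWt x.1 x.2 := by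
  simp only [map_sum, coeff_C_mul, coeff_X_pow, mul_ite, mul_one, mul_zero]
  rw [← sum_product', ← sum_filter]
  refine sum_bij (fun x _ => (x.1 + 1, x.2 + 1)) ?_ ?_ ?_ ?_
  · rintro ⟨a, b⟩ h
    exact Nat.mem_divisorsAntidiagonal.2 ⟨(mem_filter.1 h).2.symm, hn.ne'⟩
  · rintro ⟨a, b⟩ _ ⟨c, d⟩ _ h
    simpa using h
  · rintro ⟨a, b⟩ h
    obtain ⟨h, -⟩ := Nat.mem_divisorsAntidiagonal.1 h
    dsimp only at h
    have ha : 0 < a := Nat.pos_of_ne_zero (by rintro rfl; omega)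
    have hb : 0 < b := Nat.pos_of_ne_zero (by rintro rfl; omega)
    have ha' : a ≤ n := h ▸ Nat.le_mul_of_pos_right a hb
    have hb' : b ≤ n := h ▸ Nat.le_mul_of_pos_left b ha
    refine ⟨(a - 1, b - 1), ?_, by simp only [Nat.sub_add_cancel ha, Nat.sub_add_cancel hb]⟩
    simp only [mem_filter, mem_product, mem_range, Nat.sub_add_cancel ha, Nat.sub_add_cancel hb]
    exact ⟨⟨by omega, by omega⟩, h.symm⟩
  · intros
    rfl

/-- The two generating functions agree modulo `X ^ M`. -/
lemma mk_sum_dilatedSeries_eq_mk_sum_lambertWt (M : ℕ) :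
    Ideal.Quotient.mk (Ideal.span {(X : ℤ⟦X⟧) ^ M})
        (∑ L ∈ range M, -((∏ i ∈ range L, dilatedSeries (i + 1) innerWt) *
          dilatedSeries (L + 1) lastWt)) =
      Ideal.Quotient.mk (Ideal.span {(X : ℤ⟦X⟧) ^ M})
        (∑ a ∈ range M, ∑ b ∈ range M,
          C (lambertWt (a + 1) (b + 1)) * X ^ ((a + 1) * (b + 1))) := by
  set π := Ideal.Quotient.mk (Ideal.span {(X : ℤ⟦X⟧) ^ M}) with hπ
  set q := π X with hq_def
  have hq : q ^ M = 0 := by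
    rw [hq_def, ← map_pow, hπ, Ideal.Quotient.eq_zero_iff_mem]
    exact Ideal.mem_span_singleton_self _
  have hqi : ∀ i, (q ^ (i + 1)) ^ M = 0 := fun i => by
    rw [← pow_mul, mul_comm, pow_mul, hq, zero_pow i.succ_ne_zero]
  obtain ⟨w, hw⟩ : ∃ w : ℕ → ℤ⟦X⟧ ⧸ Ideal.span {(X : ℤ⟦X⟧) ^ M},
      ∀ i, (1 + q ^ (i + 1)) * w (i + 1) = 1 := by
    refine ⟨fun i => ∑ k ∈ range M, (-q ^ i) ^ k, fun i => ?_⟩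
    have h := mul_neg_geom_sum (-q ^ (i + 1)) M
    rwa [neg_pow_pow_eq_zero hq, sub_neg_eq_add, sub_zero] at h
  have hinner : ∀ i, π (dilatedSeries (i + 1) innerWt) =
      (1 - q ^ (i + 1)) * w (i + 1) * (-q ^ (i + 1) * w (i + 1)) := by
    intro i
    have h := one_add_sq_mul_sum_innerWt (hqi i)
    rw [← mk_dilatedSeries M i.succ_pos] at h
    have hw2 : (1 + q ^ (i + 1)) ^ 2 * w (i + 1) ^ 2 = 1 := by rw [← mul_pow, hw, one_pow]
    linear_combination w (i + 1) ^ 2 * h - π (dilatedSeries (i + 1) innerWt) * hw2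
  have hlast : ∀ i, π (dilatedSeries (i + 1) lastWt) =
      w (i + 1) * (-q ^ (i + 1) * w (i + 1)) := by
    intro i
    have h := one_add_sq_mul_sum_lastWt (hqi i)
    rw [← mk_dilatedSeries M i.succ_pos] at h
    have hw2 : (1 + q ^ (i + 1)) ^ 2 * w (i + 1) ^ 2 = 1 := by rw [← mul_pow, hw, one_pow]
    linear_combination w (i + 1) ^ 2 * h - π (dilatedSeries (i + 1) lastWt) * hw2
  have hleft : ∀ L, π (-((∏ i ∈ range L, dilatedSeries (i + 1) innerWt) *
      dilatedSeries (L + 1) lastWt)) =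
        -(qPochRatio q w L * w (L + 1) * qShiftProd q w 0 (L + 1)) := by
    intro L
    rw [map_neg, map_mul, map_prod, hlast, prod_congr rfl fun i _ => hinner i, prod_mul_distrib]
    simp only [qPochRatio, qShiftProd, prod_range_succ, zero_add]
    ring
  rw [map_sum, sum_congr rfl fun L _ => hleft L, sum_qPochRatio_mul_qShiftProd hw hq,
    sum_inv_sub_eq_sum_lambertWt hw hq]
  simp only [map_sum, map_mul, map_pow, ← hq_def]
  refine sum_congr rfl fun a _ => sum_congr rfl fun b _ => ?_
  congr 1
  rw [← map_intCast π]
  simp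

lemma coeff_eq_of_mk_eq {M m : ℕ} (hm : m < M) {f g : ℤ⟦X⟧}
    (h : Ideal.Quotient.mk (Ideal.span {(X : ℤ⟦X⟧) ^ M}) f = Ideal.Quotient.mk _ g) :
    coeff m f = coeff m g := by
  rw [Ideal.Quotient.eq, Ideal.mem_span_singleton, X_pow_dvd_iff] at h
  have := h m hm
  rwa [map_sub, sub_eq_zero] at this

end Truncation

theorem stmt7 (n : ℕ) (hn : 0 < n) :
    (n.divisors.card : ℤ) - 4 * ((n.divisors.filter fun d => d % 4 = 2).card : ℤ)
      = ∑ p ∈ Pstar n, (-1 : ℤ) ^ (numParts p - 1) * omegaWt p := by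
  rw [sum_Pstar_signed_omegaWt hn, coeff_eq_of_mk_eq n.lt_succ_self
    (mk_sum_dilatedSeries_eq_mk_sum_lambertWt (n + 1)), coeff_sum_lambertWt hn, sum_lambertWt]
end

section
/- For every positive integer n, the number of overpartitions of n satisfies p̄(n) = 2 · ∑_{π ∈ P*(n)} ω(π), where ω(π) := ν(ℓ(π)) · ∏_{i=1}^{ℓ(π)-1} (2ν(i) - 1). -/
open Finset

open scoped Classical

/-- `p̄(n)`: the number of overpartitions of `n`, via `p̄(n) = ∑_{π ∈ P(n)} 2^{ν_d(π)}`. -/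
def overpartition (n : ℕ) : ℕ := ∑ p : n.Partition, 2 ^ numDistinctParts p

open PowerSeries

/-- The power series `∑ c, f c * X ^ (i * c)` (for `i ≠ 0`). -/
noncomputable def dilate (i : ℕ) (f : ℕ → ℤ) : ℤ⟦X⟧ :=
  PowerSeries.mk fun m => if i ∣ m then f (m / i) else 0

/-- The geometric series `∑ c, X ^ (i * c)` (for `i ≠ 0`). -/
noncomputable def geomSeries (i : ℕ) : ℤ⟦X⟧ := dilate i 1

theorem dilate_mul_one_sub {i : ℕ} (hi : 0 < i) {f g : ℕ → ℤ} (h0 : g 0 = f 0)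
    (hs : ∀ c, g (c + 1) = f (c + 1) - f c) :
    dilate i f * (1 - X ^ i) = dilate i g := by
  ext m
  rw [mul_sub, mul_one, map_sub, coeff_mul_X_pow']
  simp only [dilate, coeff_mk]
  by_cases hd : i ∣ m
  · obtain ⟨c, rfl⟩ := hd
    cases c with
    | zero => simp [h0, hi.ne']
    | succ c =>
      have h : i * (c + 1) - i = i * c := by rw [mul_add, mul_one, Nat.add_sub_cancel]
      have h' : i ≤ i * (c + 1) := Nat.le_mul_of_pos_right i c.succ_pos
      simp [h, h', hi, hs]
  · have : ¬ (i ≤ m ∧ i ∣ m - i) := fun ⟨h1, h2⟩ =>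
      hd ((Nat.dvd_sub_iff_left h1 dvd_rfl).1 h2)
    split_ifs <;> simp_all

theorem dilate_indicator {i : ℕ} (hi : 0 < i) (a : ℕ) :
    dilate i (fun c => if c = a then 1 else 0) = X ^ (i * a) := by
  ext m
  simp only [dilate, coeff_mk, coeff_X_pow]
  by_cases hd : i ∣ m
  · obtain ⟨c, rfl⟩ := hd
    simp [hi.ne']
  · have : m ≠ i * a := fun h => hd ⟨a, h⟩
    simp [hd, this]

theorem geomSeries_mul_one_sub {i : ℕ} (hi : 0 < i) : geomSeries i * (1 - X ^ i) = 1 := by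
  rw [geomSeries, dilate_mul_one_sub hi (g := fun c => if c = 0 then 1 else 0) (by simp) (by simp),
    dilate_indicator hi, mul_zero, pow_zero]

theorem eq_mul_geomSeries {i : ℕ} (hi : 0 < i) {a b : ℤ⟦X⟧} (h : a * (1 - X ^ i) = b) :
    a = b * geomSeries i := by
  rw [← h, mul_assoc, mul_comm _ (geomSeries i), geomSeries_mul_one_sub hi, mul_one]

theorem dilate_add (i : ℕ) (f g : ℕ → ℤ) : dilate i (f + g) = dilate i f + dilate i g := by
  ext m
  simp only [dilate, coeff_mk, map_add]
  split_ifs <;> simp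

theorem dilate_ite_one_two {i : ℕ} (hi : 0 < i) :
    dilate i (fun c => if c = 0 then 1 else 2) = (1 + X ^ i) * geomSeries i := by
  apply eq_mul_geomSeries hi
  rw [dilate_mul_one_sub hi
    (g := (fun c => if c = 0 then 1 else 0) + fun c => if c = 1 then 1 else 0) (by simp)
    (by rintro (_ | c) <;> simp), dilate_add, dilate_indicator hi, dilate_indicator hi]
  simp

theorem dilate_natCast {i : ℕ} (hi : 0 < i) :
    dilate i (fun c => (c : ℤ)) = X ^ i * geomSeries i ^ 2 := by
  rw [pow_two, ← mul_assoc]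
  apply eq_mul_geomSeries hi
  apply eq_mul_geomSeries hi
  rw [dilate_mul_one_sub hi (g := fun c => if c = 0 then 0 else 1) (by simp) (by simp),
    dilate_mul_one_sub hi (g := fun c => if c = 1 then 1 else 0) (by simp)
    (by rintro (_ | c) <;> simp), dilate_indicator hi, mul_one]

theorem dilate_odd {i : ℕ} (hi : 0 < i) :
    dilate i (fun c => if c = 0 then 0 else 2 * (c : ℤ) - 1) =
      X ^ i * geomSeries i ^ 2 * (1 + X ^ i) := by
  rw [pow_two, ← mul_assoc, mul_right_comm _ _ (1 + _), mul_right_comm _ _ (1 + _)]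
  apply eq_mul_geomSeries hi
  apply eq_mul_geomSeries hi
  rw [dilate_mul_one_sub hi (g := fun c => if c = 0 then 0 else if c = 1 then 1 else 2) (by simp)
      (by rintro (_ | c) <;> simp; ring),
    dilate_mul_one_sub hi
    (g := (fun c => if c = 1 then 1 else 0) + fun c => if c = 2 then 1 else 0) (by simp)
    (by rintro (_ | _ | c) <;> simp), dilate_add, dilate_indicator hi, dilate_indicator hi]
  ring

/-- Partitions with parts in `{1, …, N}`, weighted multiplicatively by the multiplicities of all
`i ∈ {1, …, N}` (zero multiplicities included), are generated by a finite product. -/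
theorem sum_prod_count_eq_coeff (f : ℕ → ℕ → ℤ) (N n : ℕ) :
    ∑ p : n.Partition with p.parts.toFinset ⊆ Icc 1 N, ∏ i ∈ Icc 1 N, f i (p.parts.count i) =
      coeff n (∏ i ∈ Icc 1 N, dilate i (f i)) := by
  rw [coeff_prod]
  refine sum_of_injOn Nat.Partition.toFinsuppAntidiag
    (Nat.Partition.toFinsuppAntidiag_injective n).injOn ?_ ?_ ?_
  · intro p hp
    simp only [coe_filter, mem_univ, true_and, Set.mem_ofPred_eq] at hp
    have h := p.toFinsuppAntidiag_mem_finsuppAntidiag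
    rw [mem_finsuppAntidiag'] at h
    simp only [mem_coe, mem_finsuppAntidiag']
    exact ⟨h.1, hp⟩
  · intro g hg hg'
    by_contra hne
    have hdvd : ∀ i, i ∣ g i := by
      intro i
      by_cases hi : i ∈ Icc 1 N
      · have := Finset.prod_ne_zero_iff.1 hne i hi
        simp only [dilate, coeff_mk] at this
        by_contra h
        simp [h] at this
      · have : g i = 0 := by
          by_contra h
          exact hi ((mem_finsuppAntidiag'.1 hg).2 (Finsupp.mem_support_iff.2 h))
        simp [this]
    obtain ⟨h1, h2⟩ := mem_finsuppAntidiag'.1 hg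
    have hpos : ∀ i, g i ≠ 0 → 0 < i := fun i h =>
      (mem_Icc.1 (h2 (Finsupp.mem_support_iff.2 h))).1
    refine hg' ⟨Nat.Partition.mk (Finsupp.mk g.support (fun i => g i / i) ?_).toMultiset ?_ ?_,
      ?_, ?_⟩
    · intro i
      rw [Finsupp.mem_support_iff, Ne, Ne, Nat.div_eq_zero_iff]
      have h1 := hpos i
      have h2 : 0 < g i → i ≤ g i := fun h => Nat.le_of_dvd h (hdvd i)
      omega
    · intro i hi
      exact hpos i (by simpa using hi)
    · rw [← h1]
      simp [Finsupp.sum, Nat.div_mul_cancel (hdvd _)]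
    · simp only [coe_filter, mem_univ, true_and, Set.mem_ofPred_eq]
      simpa using h2
    · ext x
      simpa [Nat.Partition.toFinsuppAntidiag] using Nat.div_mul_cancel (hdvd x)
  · intro p _
    refine Finset.prod_congr rfl fun i hi => ?_
    have hi : 0 < i := (mem_Icc.1 hi).1
    simp [dilate, Nat.Partition.toFinsuppAntidiag, hi]

theorem overpartition_eq_coeff (n : ℕ) :
    (overpartition n : ℤ) = coeff n (∏ i ∈ Icc 1 n, (1 + X ^ i) * geomSeries i) := by
  rw [← Finset.prod_congr rfl fun i hi => dilate_ite_one_two (mem_Icc.1 hi).1,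
    ← sum_prod_count_eq_coeff fun _ c => if c = 0 then 1 else 2, overpartition]
  have hsub : ∀ p : n.Partition, p.parts.toFinset ⊆ Icc 1 n := by
    intro p i hi
    grind
  rw [filter_true_of_mem fun p _ => hsub p]
  push_cast
  refine Finset.sum_congr rfl fun p _ => ?_
  rw [numDistinctParts, ← Finset.prod_const, ← Finset.prod_subset (hsub p)]
  · refine Finset.prod_congr rfl fun i hi => ?_
    rw [if_neg (Multiset.count_ne_zero.2 (Multiset.mem_toFinset.1 hi))]
  · intro i _ hi
    rw [if_pos (Multiset.count_eq_zero.2 (by simpa using hi))]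

theorem sup_Icc_one_id (k : ℕ) : (Icc 1 k).sup id = k := by
  refine le_antisymm (Finset.sup_le fun i hi => (mem_Icc.1 hi).2) ?_
  cases k with
  | zero => simp
  | succ k => exact Finset.le_sup (f := id) (by simp)

theorem sum_Pstar_largestPart_eq_coeff (n k : ℕ) :
    ∑ p ∈ Pstar n with largestPart p = k + 1, omegaWt p =
      coeff n ((∏ i ∈ Icc 1 (k + 1), X ^ i * geomSeries i ^ 2) * ∏ i ∈ Icc 1 k, (1 + X ^ i)) := by
  have hprod : (∏ i ∈ Icc 1 (k + 1), X ^ i * geomSeries i ^ 2) * ∏ i ∈ Icc 1 k, (1 + X ^ i) =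
      ∏ i ∈ Icc 1 (k + 1), dilate i
        (fun c => if i = k + 1 then (c : ℤ) else if c = 0 then 0 else 2 * (c : ℤ) - 1) := by
    rw [Finset.prod_Icc_succ_top (by omega), Finset.prod_Icc_succ_top (by omega), mul_right_comm,
      ← Finset.prod_mul_distrib]
    simp only [if_true, dilate_natCast k.succ_pos]
    congr 1
    refine Finset.prod_congr rfl fun i hi => ?_
    rw [mem_Icc] at hi
    simp only [if_neg (show i ≠ k + 1 by omega), dilate_odd hi.1]
  rw [hprod, ← sum_prod_count_eq_coeff
    fun i c => if i = k + 1 then (c : ℤ) else if c = 0 then 0 else 2 * (c : ℤ) - 1]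
  have hmem : ∀ p : n.Partition,
      p ∈ {p ∈ Pstar n | largestPart p = k + 1} ↔ p.parts.toFinset = Icc 1 (k + 1) := by
    intro p
    simp only [Pstar, mem_filter, mem_univ, true_and]
    refine ⟨fun h => h.2 ▸ h.1, fun h => ?_⟩
    have hl : largestPart p = k + 1 := by rw [largestPart, h, sup_Icc_one_id]
    rw [hl]
    exact ⟨h, rfl⟩
  refine Eq.trans ?_ (Finset.sum_subset (s₁ := {p ∈ Pstar n | largestPart p = k + 1}) ?_ ?_)
  · refine Finset.sum_congr rfl fun p hp => ?_
    have hl := (mem_filter.1 hp).2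
    rw [hmem] at hp
    rw [omegaWt, hl, Finset.prod_Icc_succ_top (by omega), if_pos rfl, mul_comm,
      Nat.add_sub_cancel]
    congr 1
    refine Finset.prod_congr rfl fun i hi => ?_
    rw [mem_Icc] at hi
    have hi' : i ∈ p.parts := by
      rw [← Multiset.mem_toFinset, hp, mem_Icc]
      omega
    rw [if_neg (by omega), if_neg (Multiset.count_ne_zero.2 hi'), mult]
  · intro p hp
    simpa using ((hmem p).1 hp).le
  · intro p hp hp'
    rw [hmem] at hp'
    obtain ⟨i, hi, hi'⟩ := Finset.exists_of_ssubset ((mem_filter.1 hp).2.ssubset_of_ne hp')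
    refine Finset.prod_eq_zero hi ?_
    simp [Multiset.count_eq_zero.2 (fun h => hi' (Multiset.mem_toFinset.2 h))]

theorem prod_Icc_one_eq_prod_range (f : ℕ → ℤ⟦X⟧) (k : ℕ) :
    ∏ i ∈ Icc 1 k, f i = ∏ i ∈ range k, f (i + 1) := by
  induction k with
  | zero => simp
  | succ k ih => rw [Finset.prod_Icc_succ_top (by omega), Finset.prod_range_succ, ih]

/-- The elementary symmetric polynomials of `X, X ^ 2, …, X ^ N`. -/
noncomputable def esymmPowers : ℕ → ℕ → ℤ⟦X⟧
  | _, 0 => 1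
  | 0, _ + 1 => 0
  | N + 1, k + 1 => esymmPowers N (k + 1) + X ^ (N + 1) * esymmPowers N k

@[simp]
theorem esymmPowers_zero_right (N : ℕ) : esymmPowers N 0 = 1 := by
  cases N <;> rfl

theorem esymmPowers_succ (N k : ℕ) :
    esymmPowers (N + 1) (k + 1) = esymmPowers N (k + 1) + X ^ (N + 1) * esymmPowers N k := rfl

theorem esymmPowers_eq_zero {N k : ℕ} (h : N < k) : esymmPowers N k = 0 := by
  induction N generalizing k with
  | zero => obtain ⟨k, rfl⟩ := Nat.exists_eq_succ_of_ne_zero h.ne'; rfl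
  | succ N ih =>
    obtain ⟨k, rfl⟩ := Nat.exists_eq_succ_of_ne_zero (Nat.ne_zero_of_lt h)
    rw [Nat.succ_eq_add_one, esymmPowers_succ, ih (by omega), ih (by omega), mul_zero, add_zero]

theorem one_sub_mul_esymmPowers (N k : ℕ) :
    (1 - X ^ (k + 1)) * esymmPowers N (k + 1) =
      (X ^ (k + 1) - X ^ (N + 1)) * esymmPowers N k := by
  induction N generalizing k with
  | zero => cases k <;> simp [esymmPowers_eq_zero]
  | succ N ih =>
    cases k with
    | zero =>
      have := ih 0
      rw [esymmPowers_succ]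
      simp only [esymmPowers_zero_right] at this ⊢
      linear_combination this
    | succ k =>
      rw [esymmPowers_succ N (k + 1), esymmPowers_succ N k]
      linear_combination ih (k + 1) + X ^ (N + 2) * ih k

theorem X_pow_dvd_esymmPowers_sub (N k : ℕ) :
    X ^ (N + 1) ∣ esymmPowers N k - ∏ i ∈ range k, X ^ (i + 1) * geomSeries (i + 1) := by
  induction k with
  | zero => simp
  | succ k ih =>
    obtain ⟨c, hc⟩ := ih
    refine ⟨geomSeries (k + 1) * (X ^ (k + 1) * c - esymmPowers N k), ?_⟩
    rw [Finset.prod_range_succ]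
    linear_combination geomSeries (k + 1) * one_sub_mul_esymmPowers N k -
      esymmPowers N (k + 1) * geomSeries_mul_one_sub k.add_one_pos +
      X ^ (k + 1) * geomSeries (k + 1) * hc

/-- A terminating `q`-Chu–Vandermonde summation. -/
theorem prod_eq_sum_esymmPowers (N m : ℕ) :
    ∏ i ∈ range N, (1 + X ^ (i + 1)) * geomSeries (m + i + 1) =
      ∑ k ∈ range (N + 1), esymmPowers N k *
        ∏ i ∈ range k, (1 + X ^ (m + i)) * geomSeries (m + i + 1) := by
  induction N generalizing m with
  | zero => simp
  | succ N ih =>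
    rw [Finset.sum_range_succ']
    simp only [esymmPowers_succ, add_mul (esymmPowers _ _), Finset.sum_add_distrib]
    have h1 := ih m
    have h2 := ih (m + 1)
    rw [Finset.sum_range_succ'] at h1
    rw [Finset.sum_range_succ, esymmPowers_eq_zero (Nat.lt_succ_self N)]
    have h3 : ∑ k ∈ range (N + 1), X ^ (N + 1) * esymmPowers N k *
        ∏ i ∈ range (k + 1), (1 + X ^ (m + i)) * geomSeries (m + i + 1) =
        X ^ (N + 1) * (1 + X ^ m) * geomSeries (m + 1) * ∑ k ∈ range (N + 1), esymmPowers N k *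
          ∏ i ∈ range k, (1 + X ^ (m + 1 + i)) * geomSeries (m + 1 + i + 1) := by
      rw [Finset.mul_sum]
      refine Finset.sum_congr rfl fun k _ => ?_
      rw [Finset.prod_range_succ']
      simp only [add_zero, add_right_comm m _ 1, ← add_assoc]
      ring
    have h4 : geomSeries (m + 1) *
        ∏ i ∈ range N, (1 + X ^ (i + 1)) * geomSeries (m + 1 + i + 1) =
        geomSeries (m + N + 1) * ∏ i ∈ range N, (1 + X ^ (i + 1)) * geomSeries (m + i + 1) := by
      have h5 := (Finset.prod_range_succ' (fun i => geomSeries (m + i + 1)) N).symm.trans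
        (Finset.prod_range_succ _ N)
      simp only [add_zero, ← add_assoc] at h5
      simp only [Finset.prod_mul_distrib, add_right_comm m 1]
      linear_combination (∏ i ∈ range N, (1 + X ^ (i + 1) : ℤ⟦X⟧)) * h5
    rw [h3, ← h2, Finset.prod_range_succ]
    simp only [esymmPowers_zero_right] at h1 ⊢
    linear_combination h1 - X ^ (N + 1) * (1 + X ^ m) * h4 +
      (∏ i ∈ range N, (1 + X ^ (i + 1)) * geomSeries (m + i + 1)) *
        geomSeries_mul_one_sub (m + N).add_one_pos

theorem stmt8 (n : ℕ) (hn : 0 < n) :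
    (overpartition n : ℤ) = 2 * ∑ p ∈ Pstar n, omegaWt p := by
  have hfib : ∀ p ∈ Pstar n, largestPart p - 1 ∈ range n := by
    intro p hp
    have : largestPart p ≤ n := Finset.sup_le fun i hi => by simp only [id]; grind
    rw [mem_range]
    omega
  rw [← Finset.sum_fiberwise_of_maps_to hfib]
  have hpos : ∀ p : n.Partition, largestPart p ≠ 0 := by
    intro p h
    have h0 : p.parts = 0 := Multiset.eq_zero_of_forall_notMem fun i hi => by
      have := Finset.le_sup (f := id) (Multiset.mem_toFinset.2 hi)
      have := p.parts_pos hi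
      simp only [largestPart, id] at *
      omega
    have := p.parts_sum
    simp [h0] at this
    omega
  have hterm : ∀ k, 2 * ∑ p ∈ Pstar n with largestPart p - 1 = k, omegaWt p =
      coeff n (esymmPowers n (k + 1) *
        ∏ i ∈ range (k + 1), (1 + X ^ i) * geomSeries (i + 1)) := by
    intro k
    have hk : ∀ p : n.Partition, largestPart p - 1 = k ↔ largestPart p = k + 1 := by
      intro p
      have := hpos p
      omega
    obtain ⟨c, hc⟩ := X_pow_dvd_esymmPowers_sub n (k + 1)
    simp only [hk, sum_Pstar_largestPart_eq_coeff]
    rw [sub_eq_iff_eq_add.1 hc, add_mul, map_add, mul_assoc, coeff_X_pow_mul', if_neg (by omega),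
      zero_add, prod_Icc_one_eq_prod_range, prod_Icc_one_eq_prod_range, ← Finset.prod_mul_distrib,
      two_mul, ← map_add]
    congr 1
    have h2 := Finset.prod_range_succ' (fun i => (1 + X ^ i : ℤ⟦X⟧)) k
    simp only [Finset.prod_mul_distrib, pow_two] at h2 ⊢
    rw [h2]
    ring
  have hmain := congrArg (coeff n) (prod_eq_sum_esymmPowers n 0)
  simp only [zero_add] at hmain
  rw [overpartition_eq_coeff, prod_Icc_one_eq_prod_range, hmain, Finset.sum_range_succ', map_add,
    Finset.mul_sum, map_sum]
  simp [hterm, coeff_one, hn.ne']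
end

section
/- For every positive integer n, d(n) = 1 + ⌊n/2⌋ - ∑_{π ∈ D*(n)} (-1)^{#(π)-1} (s_2(π) - s(π)). -/
open Finset

open scoped Classical

/-- `s₂(π)`: the second smallest part of `π`. -/
noncomputable def secondSmallestPart {n : ℕ} (p : n.Partition) : ℕ :=
  sInf {j | j ∈ p.parts.erase (smallestPart p)}

/-- `D*(n)`: partitions of `n` in which only the largest part may repeat,
with the largest part occurring exactly twice and at least three parts. -/
def Dstar (n : ℕ) : Finset (n.Partition) :=
  Finset.univ.filter fun p =>
    (∀ j ∈ p.parts, j ≠ largestPart p → p.parts.count j = 1) ∧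
      mult p (largestPart p) = 2 ∧ 3 ≤ numParts p

section PowerSeriesIdentities

open PowerSeries

lemma X_pow_dvd_one_sub_prod {ι : Type*} (s : Finset ι) (f : ι → ℕ) (N : ℕ)
    (h : ∀ i ∈ s, N ≤ f i) :
    (X : PowerSeries ℤ) ^ N ∣ 1 - ∏ i ∈ s, (1 - X ^ f i) := by
  classical
  induction s using Finset.induction_on with
  | empty => simp
  | insert a s ha ih =>
    rw [Finset.prod_insert ha]
    obtain ⟨u, hu⟩ := ih fun i hi => h i (Finset.mem_insert_of_mem hi)
    obtain ⟨v, hv⟩ := pow_dvd_pow (X : PowerSeries ℤ) (h a (Finset.mem_insert_self a s))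
    exact ⟨u + v * ∏ i ∈ s, (1 - X ^ f i), by
      linear_combination hu + (∏ i ∈ s, (1 - X ^ f i)) * hv⟩

lemma isUnit_one_sub_X_pow (k : ℕ) : IsUnit (1 - (X : PowerSeries ℤ) ^ (k + 1)) := by
  rw [PowerSeries.isUnit_iff_constantCoeff]
  simp

/-- The power series `q ^ k / (1 - q ^ k)`. -/
noncomputable def multiplesSeries (k : ℕ) : PowerSeries ℤ :=
  PowerSeries.mk fun m => if k ∣ m ∧ 0 < m then 1 else 0

lemma one_sub_X_pow_mul_multiplesSeries (k : ℕ) :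
    (1 - X ^ (k + 1)) * multiplesSeries (k + 1) = X ^ (k + 1) := by
  ext m
  rw [sub_mul, one_mul, map_sub, coeff_X_pow_mul', coeff_X_pow]
  simp only [multiplesSeries, coeff_mk]
  by_cases h : k + 1 ≤ m
  · obtain ⟨t, rfl⟩ := Nat.exists_eq_add_of_le h
    rcases Nat.eq_zero_or_pos t with rfl | ht
    · simp
    · have : k + 1 ∣ k + 1 + t ↔ k + 1 ∣ t := by simp
      simp [this, ht, ht.ne']
  · have h1 : m ≠ k + 1 := by omega
    have h2 : ¬ (k + 1 ∣ m ∧ 0 < m) := fun ⟨a, b⟩ => h (Nat.le_of_dvd b a)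
    simp [h, h1, h2]

/-- The truncation `∑_{j < N} (1 - ∏_{i = 1}^{M} (1 - q ^ (i + j)))`. -/
noncomputable def shiftedSum (M N : ℕ) : PowerSeries ℤ :=
  ∑ j ∈ range N, (1 - ∏ i ∈ range M, (1 - X ^ (j + 1 + i)))

lemma shiftedSum_succ_sub (M N : ℕ) :
    (1 - X ^ (M + 1)) * (shiftedSum (M + 1) N - shiftedSum M N)
      = X ^ (M + 1) * ∏ i ∈ range (M + 1), (1 - X ^ (N + i)) := by
  induction N with
  | zero => simp [shiftedSum, Finset.prod_range_succ']
  | succ N ih =>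
    have h : ∏ i ∈ range M, (1 - (X : PowerSeries ℤ) ^ (N + (i + 1)))
        = ∏ i ∈ range M, (1 - X ^ (N + 1 + i)) :=
      Finset.prod_congr rfl fun i _ => by rw [show N + (i + 1) = N + 1 + i by ring]
    rw [Finset.prod_range_succ', h] at ih
    simp only [shiftedSum] at ih ⊢
    rw [Finset.sum_range_succ, Finset.sum_range_succ, Finset.prod_range_succ]
    linear_combination ih

lemma X_pow_dvd_shiftedSum_sub (M N : ℕ) :
    X ^ N ∣ shiftedSum M N - ∑ k ∈ range M, multiplesSeries (k + 1) := by
  induction M with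
  | zero => simp [shiftedSum]
  | succ M ih =>
    have key : X ^ N ∣ shiftedSum (M + 1) N - shiftedSum M N - multiplesSeries (M + 1) := by
      rw [← (isUnit_one_sub_X_pow M).dvd_mul_left]
      obtain ⟨u, hu⟩ := X_pow_dvd_one_sub_prod (range (M + 1)) (fun i => N + i) N
        fun i _ => Nat.le_add_right N i
      exact ⟨- X ^ (M + 1) * u, by
        linear_combination shiftedSum_succ_sub M N - one_sub_X_pow_mul_multiplesSeries M
          - X ^ (M + 1) * hu⟩
    rw [Finset.sum_range_succ]
    convert dvd_add ih key using 1
    ring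

section Recursion

variable {F : ℕ → PowerSeries ℤ}

lemma eq_sum_prod_of_recursion
    (hF : ∀ L, F (L + 1) = (1 - X ^ L) * (F L + multiplesSeries 1)) (N : ℕ) :
    F (N + 1) = multiplesSeries 1 * ∑ j ∈ range N, ∏ i ∈ Ico (j + 1) (N + 1), (1 - X ^ i) := by
  induction N with
  | zero => simp [hF 0]
  | succ N ih =>
    rw [hF, ih]
    have h : ∀ j ∈ range (N + 1), ∏ i ∈ Ico (j + 1) (N + 1 + 1), (1 - (X : PowerSeries ℤ) ^ i)
        = (∏ i ∈ Ico (j + 1) (N + 1), (1 - X ^ i)) * (1 - X ^ (N + 1)) := fun j hj => by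
      rw [Finset.prod_Ico_succ_top]
      have := Finset.mem_range.mp hj
      omega
    rw [Finset.sum_congr rfl h, ← Finset.sum_mul, Finset.sum_range_succ, Finset.Ico_self,
      Finset.prod_empty]
    ring

lemma X_pow_dvd_of_recursion
    (hF : ∀ L, F (L + 1) = (1 - X ^ L) * (F L + multiplesSeries 1)) (N : ℕ) :
    X ^ N ∣ F (N + 1)
      - multiplesSeries 1 * ((N : PowerSeries ℤ) - ∑ k ∈ range N, multiplesSeries (k + 1)) := by
  have h : X ^ N ∣ ∑ j ∈ range N, ∏ i ∈ Ico (j + 1) (N + 1), (1 - (X : PowerSeries ℤ) ^ i)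
      - ((N : PowerSeries ℤ) - shiftedSum N N) := by
    have e : (N : PowerSeries ℤ) - shiftedSum N N
        = ∑ j ∈ range N, ∏ i ∈ range N, (1 - X ^ (j + 1 + i)) := by
      simp [shiftedSum]
    rw [e, ← Finset.sum_sub_distrib]
    refine Finset.dvd_sum fun j hj => ?_
    have hj' := Finset.mem_range.mp hj
    have e2 : ∏ i ∈ range N, (1 - (X : PowerSeries ℤ) ^ (j + 1 + i))
        = (∏ i ∈ Ico (j + 1) (N + 1), (1 - X ^ i))
          * ∏ i ∈ Ico (N + 1) (j + 1 + N), (1 - X ^ i) := by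
      rw [Finset.prod_Ico_consecutive _ (by omega) (by omega), Finset.prod_Ico_eq_prod_range]
      simp
    rw [e2, ← mul_one_sub]
    refine Dvd.dvd.mul_left (X_pow_dvd_one_sub_prod _ (fun i => i) N fun i hi => ?_) _
    have := (Finset.mem_Ico.mp hi).1
    omega
  rw [eq_sum_prod_of_recursion hF]
  convert (dvd_sub h (X_pow_dvd_shiftedSum_sub N N)).mul_left (multiplesSeries 1) using 1
  ring

lemma eq_sub_sum_of_recursion (h0 : F 0 = 0)
    (hF : ∀ L, F (L + 1) = (1 - X ^ L) * (F L + multiplesSeries 1)) (N : ℕ) :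
    F N = multiplesSeries 1 * (N : PowerSeries ℤ) - ∑ L ∈ range N, X ^ L * F L
      - multiplesSeries 1 * ∑ L ∈ range N, X ^ L := by
  induction N with
  | zero => simp [h0]
  | succ N ih =>
    rw [hF, Finset.sum_range_succ, Finset.sum_range_succ]
    push_cast
    linear_combination ih

lemma sum_X_pow_mul_of_recursion (h0 : F 0 = 0)
    (hF : ∀ L, F (L + 1) = (1 - X ^ L) * (F L + multiplesSeries 1)) (N : ℕ) :
    ∑ L ∈ range N, X ^ L * F L + X ^ N * F N
      = X * (∑ L ∈ range N, X ^ L * F L + multiplesSeries 1 * ∑ L ∈ range N, X ^ L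
        - ∑ L ∈ range N, X ^ (2 * L) * F L
        - multiplesSeries 1 * ∑ L ∈ range N, X ^ (2 * L)) := by
  induction N with
  | zero => simp [h0]
  | succ N ih =>
    simp only [Finset.sum_range_succ]
    have e : (X : PowerSeries ℤ) ^ (2 * N) = X ^ N * X ^ N := by ring
    rw [hF, e]
    linear_combination ih

lemma sum_X_pow_eq (N : ℕ) :
    ∑ L ∈ range N, (X : PowerSeries ℤ) ^ L = (1 + multiplesSeries 1) * (1 - X ^ N) := by
  have h := one_sub_X_pow_mul_multiplesSeries 0
  simp only [zero_add, pow_one] at h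
  induction N with
  | zero => simp
  | succ N ih =>
    rw [Finset.sum_range_succ]
    linear_combination ih - X ^ N * h

lemma sum_X_pow_two_mul_eq (N : ℕ) :
    ∑ L ∈ range N, (X : PowerSeries ℤ) ^ (2 * L)
      = (1 + multiplesSeries 2) * (1 - X ^ (2 * N)) := by
  have h := one_sub_X_pow_mul_multiplesSeries 1
  simp only [Nat.reduceAdd] at h
  induction N with
  | zero => simp
  | succ N ih =>
    rw [Finset.sum_range_succ]
    linear_combination ih - X ^ (2 * N) * h

lemma mk_half_eq :
    (PowerSeries.mk fun m => ((m / 2 : ℕ) : ℤ))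
      = multiplesSeries 1 ^ 2 - multiplesSeries 1 * multiplesSeries 2 := by
  have h1 := one_sub_X_pow_mul_multiplesSeries 0
  have h2 := one_sub_X_pow_mul_multiplesSeries 1
  simp only [zero_add, pow_one, Nat.reduceAdd] at h1 h2
  have hW : (1 - X ^ 2) * (PowerSeries.mk fun m => ((m / 2 : ℕ) : ℤ))
      = X * multiplesSeries 1 := by
    ext m
    rw [sub_mul, one_mul, map_sub, coeff_X_pow_mul']
    rcases m with _ | _ | m
    · simp
    · simp [coeff_succ_X_mul, multiplesSeries]
    · have h : (m + 1 + 1) / 2 = m / 2 + 1 := by omega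
      simp only [coeff_mk, multiplesSeries, coeff_succ_X_mul, h]
      simp
  refine (isUnit_one_sub_X_pow 1).mul_left_cancel ?_
  simp only [Nat.reduceAdd]
  linear_combination hW + multiplesSeries 1 * h2 - (1 + X) * multiplesSeries 1 * h1

lemma X_pow_dvd_sum_X_pow_two_mul_sub (h0 : F 0 = 0)
    (hF : ∀ L, F (L + 1) = (1 - X ^ L) * (F L + multiplesSeries 1)) (N : ℕ) :
    X ^ N ∣ ∑ L ∈ range (N + 2), X ^ (2 * L) * F L
      - (multiplesSeries 1 + (PowerSeries.mk fun m => ((m / 2 : ℕ) : ℤ))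
        - ∑ k ∈ range (N + 1), multiplesSeries (k + 1)) := by
  obtain ⟨t, ht⟩ := X_pow_dvd_of_recursion hF (N + 1)
  have h1 := one_sub_X_pow_mul_multiplesSeries 0
  simp only [zero_add, pow_one] at h1
  have e1 := eq_sub_sum_of_recursion h0 hF (N + 2)
  have e2 := sum_X_pow_mul_of_recursion h0 hF (N + 2)
  rw [sum_X_pow_two_mul_eq] at e2
  rw [sum_X_pow_eq] at e1 e2
  rw [mk_half_eq]
  push_cast at e1 ht
  rw [show N + 1 + 1 = N + 2 from rfl] at ht
  generalize ∑ L ∈ range (N + 2), X ^ (2 * L) * F L = G at *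
  generalize ∑ L ∈ range (N + 2), X ^ L * F L = A at *
  generalize ∑ k ∈ range (N + 1), multiplesSeries (k + 1) = E at *
  generalize multiplesSeries 1 = c at *
  generalize multiplesSeries 2 = d at *
  have hX : (X : PowerSeries ℤ) ^ (N + 1) ∣ X * (G - (c + (c ^ 2 - c * d) - E)) := by
    refine ⟨(1 - X) * t - X ^ 2 * (1 + c) - X ^ 2 * c * (1 + c)
      + X ^ 2 * c * (1 + d) * X ^ (N + 2) - X * F (N + 2), ?_⟩
    linear_combination e2 - (1 - X) * e1 + (1 - X) * ht + (c - E - (1 + c) * X ^ (N + 2)) * h1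
  rw [pow_succ', mul_dvd_mul_iff_left PowerSeries.X_ne_zero] at hX
  exact hX

end Recursion

lemma coeff_sum_multiplesSeries {n N : ℕ} (hn : 0 < n) (h : n ≤ N) :
    coeff n (∑ k ∈ range N, multiplesSeries (k + 1)) = (n.divisors.card : ℤ) := by
  simp only [map_sum, multiplesSeries, coeff_mk, hn, and_true]
  rw [Finset.sum_boole]
  congr 1
  refine Finset.card_bij (fun k _ => k + 1) ?_ ?_ ?_
  · simp only [Finset.mem_filter, Nat.mem_divisors]
    exact fun k hk => ⟨hk.2, hn.ne'⟩
  · intro a _ b _ h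
    omega
  · intro d hd
    have h1 := Nat.pos_of_mem_divisors hd
    have h2 := Nat.divisor_le hd
    have h3 := Nat.dvd_of_mem_divisors hd
    refine ⟨d - 1, ?_, by omega⟩
    rw [Finset.mem_filter, Finset.mem_range, Nat.sub_add_cancel h1]
    exact ⟨by omega, h3⟩

/-- The number of thresholds `k < L` such that exactly one element of `S` is at most `k`. For
nonempty `S` bounded by `L` this is the gap between the two smallest elements of `S ∪ {L}`. -/
def gap (L : ℕ) (S : Finset ℕ) : ℕ := #{k ∈ range L | #{s ∈ S | s ≤ k} = 1}

lemma gap_empty (L : ℕ) : gap L ∅ = 0 := by simp [gap]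

lemma gap_succ {L : ℕ} {S : Finset ℕ} (hS : S ⊆ Ioo 0 L) :
    gap (L + 1) S = gap L S + if #S = 1 then 1 else 0 := by
  have h : {s ∈ S | s ≤ L} = S := Finset.filter_true_of_mem fun s hs =>
    (Finset.mem_Ioo.mp (hS hs)).2.le
  rw [gap, gap, Finset.range_add_one, Finset.filter_insert, h]
  split_ifs with h1
  · rw [Finset.card_insert_of_notMem (by simp)]
  · simp

lemma gap_succ_insert {L : ℕ} {S : Finset ℕ} (hS : S ⊆ Ioo 0 L) :
    gap (L + 1) (insert L S) = gap L S + if S = ∅ then 1 else 0 := by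
  have hL : L ∉ S := fun h => by simpa using hS h
  have h : #{s ∈ insert L S | s ≤ L} = #S + 1 := by
    rw [Finset.filter_true_of_mem, Finset.card_insert_of_notMem hL]
    intro s hs
    rcases Finset.mem_insert.mp hs with rfl | hs
    · exact le_rfl
    · exact (Finset.mem_Ioo.mp (hS hs)).2.le
  have h2 : ∀ k ∈ range L, #{s ∈ insert L S | s ≤ k} = 1 ↔ #{s ∈ S | s ≤ k} = 1 := by
    intro k hk
    rw [Finset.filter_insert, if_neg (by simpa using hk)]
  rw [gap, gap, Finset.range_add_one, Finset.filter_insert, h, Finset.filter_congr h2]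
  simp only [Nat.add_eq_right, Finset.card_eq_zero]
  split_ifs with h1
  · rw [Finset.card_insert_of_notMem (by simp)]
  · simp

/-- The signed generating function, weighted by `gap L`, of the subsets of `{1, …, L - 1}`. -/
noncomputable def gapSeries (L : ℕ) : PowerSeries ℤ :=
  ∑ S ∈ (Ioo 0 L).powerset, (-1) ^ (#S + 1) * (gap L S : PowerSeries ℤ) * X ^ (∑ s ∈ S, s)

lemma gapSeries_zero : gapSeries 0 = 0 := by simp [gapSeries, gap]

lemma gapSeries_succ (L : ℕ) :
    gapSeries (L + 1) = (1 - X ^ L) * (gapSeries L + multiplesSeries 1) := by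
  rcases Nat.eq_zero_or_pos L with rfl | hL
  · have h : Ioo 0 (0 + 1) = ∅ := rfl
    simp [gapSeries, gap_empty, h]
  have hI : Ioo 0 (L + 1) = insert L (Ioo 0 L) := by
    ext x
    simp only [Finset.mem_Ioo, Finset.mem_insert]
    omega
  have hnot : L ∉ Ioo 0 L := by simp
  have hsingle : ∑ S ∈ (Ioo 0 L).powerset,
      (if #S = 1 then (X : PowerSeries ℤ) ^ (∑ s ∈ S, s) else 0)
      = ∑ i ∈ Ioo 0 L, X ^ i := by
    rw [← Finset.sum_filter, ← Finset.powersetCard_eq_filter, Finset.powersetCard_one,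
      Finset.sum_map]
    simp
  have hgeom : ∑ i ∈ Ioo 0 L, (X : PowerSeries ℤ) ^ i + X ^ L
      = (1 - X ^ L) * multiplesSeries 1 := by
    have h1 := one_sub_X_pow_mul_multiplesSeries 0
    simp only [zero_add, pow_one] at h1
    have h2 := sum_X_pow_eq (L + 1)
    have h3 : range (L + 1) = insert 0 (insert L (Ioo 0 L)) := by
      ext x
      simp only [Finset.mem_Ioo, Finset.mem_insert, Finset.mem_range]
      omega
    rw [h3, Finset.sum_insert (by simp; omega), Finset.sum_insert hnot] at h2
    linear_combination h2 + X ^ L * h1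
  have hA : ∑ S ∈ (Ioo 0 L).powerset,
      (-1) ^ (#S + 1) * (gap (L + 1) S : PowerSeries ℤ) * X ^ (∑ s ∈ S, s)
        = gapSeries L + ∑ i ∈ Ioo 0 L, X ^ i := by
    rw [← hsingle, gapSeries, ← Finset.sum_add_distrib]
    refine Finset.sum_congr rfl fun S hS => ?_
    rw [gap_succ (Finset.mem_powerset.mp hS)]
    split_ifs with h
    · rw [h]
      push_cast
      ring
    · simp
  have hB : ∑ S ∈ (Ioo 0 L).powerset,
      (-1) ^ (#(insert L S) + 1) * (gap (L + 1) (insert L S) : PowerSeries ℤ)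
        * X ^ (∑ s ∈ insert L S, s) = - X ^ L * gapSeries L + X ^ L := by
    have hL' : (X : PowerSeries ℤ) ^ L
        = ∑ S ∈ (Ioo 0 L).powerset, if S = ∅ then X ^ L else 0 := by
      rw [Finset.sum_ite_eq' _ ∅]
      simp
    conv_rhs => rw [gapSeries, Finset.mul_sum]; enter [2]; rw [hL']
    rw [← Finset.sum_add_distrib]
    refine Finset.sum_congr rfl fun S hS => ?_
    have hS' := Finset.mem_powerset.mp hS
    have hLS : L ∉ S := fun h => hnot (hS' h)
    rw [gap_succ_insert hS', Finset.card_insert_of_notMem hLS, Finset.sum_insert hLS]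
    split_ifs with h
    · simp [h, gap_empty]
    · push_cast
      ring
  rw [gapSeries, hI, Finset.sum_powerset_insert hnot, hA, hB]
  linear_combination hgeom

end PowerSeriesIdentities

section Partitions

variable {n : ℕ} {p : n.Partition} {L : ℕ} {S : Finset ℕ}

lemma largestPart_eq (hS : S ⊆ Ioo 0 L) (hp : p.parts = L ::ₘ L ::ₘ S.val) :
    largestPart p = L := by
  rw [largestPart, hp]
  apply le_antisymm
  · refine Finset.sup_le fun x hx => ?_
    simp only [Multiset.mem_toFinset, Multiset.mem_cons, Finset.mem_val] at hx
    rcases hx with rfl | rfl | hx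
    · exact le_rfl
    · exact le_rfl
    · exact (Finset.mem_Ioo.mp (hS hx)).2.le
  · exact Finset.le_sup (f := id) (by simp)

lemma smallestPart_mem_and_le (hS : S ⊆ Ioo 0 L) (hne : S.Nonempty)
    (hp : p.parts = L ::ₘ L ::ₘ S.val) :
    smallestPart p ∈ S ∧ ∀ s ∈ S, smallestPart p ≤ s := by
  have hle : ∀ s ∈ S, smallestPart p ≤ s := fun s hs => Nat.sInf_le (by simp [hp, hs])
  refine ⟨?_, hle⟩
  have hmem : smallestPart p ∈ p.parts :=
    Nat.sInf_mem (s := {j | j ∈ p.parts}) ⟨L, by simp [hp]⟩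
  simp only [hp, Multiset.mem_cons, Finset.mem_val] at hmem
  obtain ⟨s, hs⟩ := hne
  have h1 := hle s hs
  have h2 := (Finset.mem_Ioo.mp (hS hs)).2
  rcases hmem with h | h | h
  · omega
  · omega
  · exact h

lemma secondSmallestPart_sub_smallestPart (hS : S ⊆ Ioo 0 L) (hne : S.Nonempty)
    (hp : p.parts = L ::ₘ L ::ₘ S.val) :
    (secondSmallestPart p : ℤ) - smallestPart p = gap L S := by
  obtain ⟨hm, hle⟩ := smallestPart_mem_and_le hS hne hp
  have hmL := (Finset.mem_Ioo.mp (hS hm)).2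
  have hmem : ∀ j, j ∈ p.parts.erase (smallestPart p) ↔ j = L ∨ (j ∈ S ∧ j ≠ smallestPart p) := by
    intro j
    rw [hp, Multiset.erase_cons_tail _ (by simpa using hmL.ne'),
      Multiset.erase_cons_tail _ (by simpa using hmL.ne'), ← Finset.erase_val]
    simp only [Multiset.mem_cons, Finset.mem_val, Finset.mem_erase]
    tauto
  have h2mem : secondSmallestPart p ∈ p.parts.erase (smallestPart p) :=
    Nat.sInf_mem (s := {j | j ∈ p.parts.erase (smallestPart p)}) ⟨L, (hmem L).mpr (.inl rfl)⟩
  have h2le : ∀ j, j = L ∨ (j ∈ S ∧ j ≠ smallestPart p) → secondSmallestPart p ≤ j :=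
    fun j hj => Nat.sInf_le ((hmem j).mpr hj)
  rw [hmem] at h2mem
  have hlt : smallestPart p ≤ secondSmallestPart p := by
    rcases h2mem with h | h
    · omega
    · exact hle _ h.1
  have hset : {k ∈ range L | #{s ∈ S | s ≤ k} = 1}
      = Ico (smallestPart p) (secondSmallestPart p) := by
    ext k
    simp only [Finset.mem_filter, Finset.mem_range, Finset.mem_Ico]
    constructor
    · rintro ⟨hk, hcard⟩
      obtain ⟨a, ha⟩ := Finset.card_eq_one.mp hcard
      have haS : a ∈ S ∧ a ≤ k := by
        have : a ∈ {s ∈ S | s ≤ k} := ha ▸ Finset.mem_singleton_self a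
        exact Finset.mem_filter.mp this
      have hmk : smallestPart p ≤ k := (hle a haS.1).trans haS.2
      have hma : smallestPart p = a := by
        rw [← Finset.mem_singleton, ← ha, Finset.mem_filter]
        exact ⟨hm, hmk⟩
      refine ⟨hmk, ?_⟩
      by_contra! hk2
      rcases h2mem with h | h
      · omega
      · apply h.2
        rw [hma, ← Finset.mem_singleton, ← ha, Finset.mem_filter]
        exact ⟨h.1, hk2⟩
    · rintro ⟨h1, h2⟩
      refine ⟨h2.trans_le (h2le L (.inl rfl)), Finset.card_eq_one.mpr ⟨smallestPart p, ?_⟩⟩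
      ext x
      simp only [Finset.mem_filter, Finset.mem_singleton]
      constructor
      · rintro ⟨hx, hxk⟩
        by_contra hne'
        have := h2le x (.inr ⟨hx, hne'⟩)
        omega
      · rintro rfl
        exact ⟨hm, h1⟩
  rw [gap, hset, Nat.card_Ico]
  omega

lemma mem_Dstar : p ∈ Dstar n ↔
    (∀ j ∈ p.parts, j ≠ largestPart p → p.parts.count j = 1) ∧
      p.parts.count (largestPart p) = 2 ∧ 3 ≤ Multiset.card p.parts := by
  rw [Dstar, Finset.mem_filter]
  exact and_iff_right (Finset.mem_univ p)

lemma parts_eq_of_mem_Dstar (hp : p ∈ Dstar n) :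
    p.parts = largestPart p ::ₘ largestPart p ::ₘ
      (p.parts.toFinset.erase (largestPart p)).val := by
  rw [mem_Dstar] at hp
  ext j
  rw [Multiset.count_cons, Multiset.count_cons]
  by_cases h : j = largestPart p
  · subst h
    rw [hp.2.1, Multiset.count_eq_zero_of_notMem
      (Finset.notMem_erase (largestPart p) p.parts.toFinset)]
    simp
  · rw [Multiset.count_eq_of_nodup (Finset.nodup _)]
    simp only [Finset.mem_val, Finset.mem_erase, Multiset.mem_toFinset]
    by_cases hj : j ∈ p.parts
    · simp [h, hj, hp.1 j hj h]
    · simp [h, hj]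

lemma erase_largestPart_subset (p : n.Partition) :
    p.parts.toFinset.erase (largestPart p) ⊆ Ioo 0 (largestPart p) := by
  intro x hx
  rw [Finset.mem_erase] at hx
  have h1 : x ≤ largestPart p := Finset.le_sup (f := id) hx.2
  have h2 := p.parts_pos (Multiset.mem_toFinset.mp hx.2)
  exact Finset.mem_Ioo.mpr ⟨h2, lt_of_le_of_ne h1 hx.1⟩

lemma mem_Dstar_of_parts_eq (hS : S ⊆ Ioo 0 L) (hne : S.Nonempty)
    (hp : p.parts = L ::ₘ L ::ₘ S.val) : p ∈ Dstar n := by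
  have hL : L ∉ S := fun h => by simpa using hS h
  rw [mem_Dstar, largestPart_eq hS hp, hp]
  refine ⟨fun j hj hjL => ?_, ?_, ?_⟩
  · simp only [Multiset.mem_cons, hjL, false_or] at hj
    simp [hjL, Multiset.count_eq_of_nodup S.nodup, hj]
  · simp [Multiset.count_eq_zero_of_notMem (show L ∉ S.val from hL)]
  · have := hne.card_pos
    simp only [Multiset.card_cons, Finset.card_val]
    omega

lemma sum_Dstar_eq_coeff (n N : ℕ) (hN : n < N) :
    ∑ p ∈ Dstar n, (-1 : ℤ) ^ (numParts p - 1) *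
        ((secondSmallestPart p : ℤ) - (smallestPart p : ℤ))
      = PowerSeries.coeff n (∑ L ∈ range N, PowerSeries.X ^ (2 * L) * gapSeries L) := by
  have hcoeff : PowerSeries.coeff n (∑ L ∈ range N, PowerSeries.X ^ (2 * L) * gapSeries L)
      = ∑ x ∈ (range N).sigma (fun L => (Ioo 0 L).powerset),
        if n = 2 * x.1 + ∑ s ∈ x.2, s then (-1 : ℤ) ^ (#x.2 + 1) * gap x.1 x.2 else 0 := by
    rw [Finset.sum_sigma, map_sum]
    refine Finset.sum_congr rfl fun L _ => ?_
    rw [gapSeries, Finset.mul_sum, map_sum]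
    refine Finset.sum_congr rfl fun S _ => ?_
    have e : (PowerSeries.X : PowerSeries ℤ) ^ (2 * L) * ((-1) ^ (#S + 1)
        * (gap L S : PowerSeries ℤ) * PowerSeries.X ^ (∑ s ∈ S, s))
        = PowerSeries.C ((-1 : ℤ) ^ (#S + 1) * gap L S)
          * PowerSeries.X ^ (2 * L + ∑ s ∈ S, s) := by
      simp only [map_mul, map_pow, map_neg, map_one, map_natCast]
      ring
    rw [e, PowerSeries.coeff_C_mul, PowerSeries.coeff_X_pow]
    simp
  rw [hcoeff, ← Finset.sum_filter]
  have hne : ∀ q ∈ Dstar n, (q.parts.toFinset.erase (largestPart q)).Nonempty := by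
    intro q hq
    rw [← Finset.card_pos]
    have h := congrArg Multiset.card (parts_eq_of_mem_Dstar hq)
    rw [mem_Dstar] at hq
    simp only [Multiset.card_cons, Finset.card_val] at h
    omega
  have hsum : ∀ q ∈ Dstar n, n = 2 * largestPart q
      + ∑ s ∈ q.parts.toFinset.erase (largestPart q), s := by
    intro q hq
    have h := congrArg Multiset.sum (parts_eq_of_mem_Dstar hq)
    rw [q.parts_sum, Multiset.sum_cons, Multiset.sum_cons, Finset.sum_val] at h
    simp only [id] at h
    omega
  refine Finset.sum_bij_ne_zero
    (fun q _ _ => ⟨largestPart q, q.parts.toFinset.erase (largestPart q)⟩) ?_ ?_ ?_ ?_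
  · intro q hq _
    have h := hsum q hq
    rw [Finset.mem_filter, Finset.mem_sigma, Finset.mem_powerset, Finset.mem_range]
    exact ⟨⟨by dsimp only; omega, erase_largestPart_subset q⟩, h⟩
  · intro q hq _ r hr _ h
    rw [Sigma.mk.injEq] at h
    apply Nat.Partition.ext
    rw [parts_eq_of_mem_Dstar hq, parts_eq_of_mem_Dstar hr, eq_of_heq h.2, h.1]
  · rintro ⟨L, S⟩ hx hgap
    simp only [Finset.mem_filter, Finset.mem_sigma, Finset.mem_powerset, Finset.mem_range] at hx
    obtain ⟨⟨-, hS⟩, hn⟩ := hx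
    have hSne : S.Nonempty := by
      rw [Finset.nonempty_iff_ne_empty]
      rintro rfl
      simp [gap_empty] at hgap
    have hL : L ∉ S := fun h => by simpa using hS h
    have hLpos : 0 < L := by
      obtain ⟨s, hs⟩ := hSne
      have := Finset.mem_Ioo.mp (hS hs)
      omega
    let q : n.Partition :=
      { parts := L ::ₘ L ::ₘ S.val
        parts_pos := by
          intro i hi
          simp only [Multiset.mem_cons, Finset.mem_val] at hi
          rcases hi with rfl | rfl | hi
          · exact hLpos
          · exact hLpos
          · exact (Finset.mem_Ioo.mp (hS hi)).1
        parts_sum := by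
          rw [Multiset.sum_cons, Multiset.sum_cons, Finset.sum_val]
          simp only [id]
          omega }
    have hq : q.parts = L ::ₘ L ::ₘ S.val := rfl
    have hlarge := largestPart_eq hS hq
    refine ⟨q, mem_Dstar_of_parts_eq hS hSne hq, ?_, ?_⟩
    · rw [secondSmallestPart_sub_smallestPart hS hSne hq]
      refine mul_ne_zero (by simp) (right_ne_zero_of_mul hgap)
    · have : q.parts.toFinset.erase (largestPart q) = S := by
        rw [hlarge, hq]
        simp [Finset.erase_eq_of_notMem hL]
      rw [this, hlarge]
  · intro q hq _
    have hparts := parts_eq_of_mem_Dstar hq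
    rw [secondSmallestPart_sub_smallestPart (erase_largestPart_subset q) (hne q hq) hparts]
    have hcard := congrArg Multiset.card hparts
    simp only [Multiset.card_cons, Finset.card_val] at hcard
    rw [numParts, hcard, Nat.add_sub_cancel]

end Partitions

theorem stmt9 (n : ℕ) (hn : 0 < n) :
    (n.divisors.card : ℤ)
      = 1 + (n / 2 : ℕ) - ∑ p ∈ Dstar n, (-1 : ℤ) ^ (numParts p - 1) *
          ((secondSmallestPart p : ℤ) - (smallestPart p : ℤ)) := by
  have h := PowerSeries.X_pow_dvd_iff.mp
    (X_pow_dvd_sum_X_pow_two_mul_sub gapSeries_zero gapSeries_succ (n + 1)) n (Nat.lt_succ_self n)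
  rw [sum_Dstar_eq_coeff n (n + 1 + 2) (by omega)]
  rw [map_sub, map_sub, map_add, coeff_sum_multiplesSeries hn (by omega), PowerSeries.coeff_mk,
    multiplesSeries, PowerSeries.coeff_mk] at h
  simp only [isUnit_one, IsUnit.dvd, hn, and_self, if_true] at h
  linarith
end
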